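/- Let d ≥ 3 and let V : ℝ^d → ℝ be locally Hölder continuous (for every compact K ⊂ ℝ^d there are C > 0 and α ∈ (0,1] with |V(x) − V(x')| ≤ C|x − x'|^α for x, x' ∈ K). Fix r > 0. Then lim_{|y|→∞} λ₀(B_r(y); V) = +∞ if and only if there exist R > 0 and a function λ : ℝ^d → ℝ with λ(y) → +∞ as |y| → ∞ such that for every y with |y| ≥ R the Riccati equation −Δv + |∇v|² + λ(y) = V has a classical solution in the closed ball: a function v continuous on closure(B_r(y)), twice continuously differentiable on B_r(y), satisfying the equation at every point of B_r(y). -/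

import Mathlib

open MeasureTheory Metric Filter


/-- The Laplacian of a function on `ℝ^d`, as the sum of second partial derivatives. -/
noncomputable def laplacian {d : ℕ} (v : EuclideanSpace ℝ (Fin d) → ℝ)
    (x : EuclideanSpace ℝ (Fin d)) : ℝ :=
  ∑ i : Fin d, fderiv ℝ (fderiv ℝ v) x (EuclideanSpace.single i 1) (EuclideanSpace.single i 1)

/-- Euclidean space. -/
abbrev Eu (d : ℕ) := EuclideanSpace ℝ (Fin d)

/-- standard basis vector -/
noncomputable abbrev ee {d : ℕ} (i : Fin d) : Eu d := EuclideanSpace.single i (1:ℝ)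

/-- squared gradient -/
noncomputable def gsq {d : ℕ} (u : Eu d → ℝ) (x : Eu d) : ℝ :=
  ∑ i : Fin d, (fderiv ℝ u x (ee i)) ^ 2

/-- gradient product -/
noncomputable def gdot {d : ℕ} (u w : Eu d → ℝ) (x : Eu d) : ℝ :=
  ∑ i : Fin d, fderiv ℝ u x (ee i) * fderiv ℝ w x (ee i)

theorem gradient_sq {d : ℕ} (u : Eu d → ℝ) (x : Eu d) : ‖gradient u x‖ ^ 2 = gsq u x := by
  rw [EuclideanSpace.norm_sq_eq]
  unfold gsq
  refine Finset.sum_congr rfl fun i _ => ?_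
  have : gradient u x i = fderiv ℝ u x (ee i) := by
    have h1 : inner ℝ (gradient u x) (ee i) = fderiv ℝ u x (ee i) := by
      unfold gradient
      exact InnerProductSpace.toDual_symm_apply
    rw [← h1, EuclideanSpace.inner_single_right]
    simp
  rw [this, Real.norm_eq_abs, sq_abs]

theorem gsq_nonneg {d : ℕ} (u : Eu d → ℝ) (x : Eu d) : 0 ≤ gsq u x :=
  Finset.sum_nonneg fun _ _ => sq_nonneg _

theorem gsq_mul {d : ℕ} {u w : Eu d → ℝ} {x : Eu d} (hu : DifferentiableAt ℝ u x)
    (hw : DifferentiableAt ℝ w x) :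
    gsq (fun x => u x * w x) x = (u x)^2 * gsq w x + 2 * u x * w x * gdot u w x
      + (w x)^2 * gsq u x := by
  unfold gsq gdot
  rw [Finset.mul_sum, Finset.mul_sum, Finset.mul_sum, ← Finset.sum_add_distrib,
    ← Finset.sum_add_distrib]
  refine Finset.sum_congr rfl fun i _ => ?_
  rw [fderiv_fun_mul hu hw]
  simp
  ring

theorem continuous_gsq {d : ℕ} {u : Eu d → ℝ} (hu : ContDiff ℝ 1 u) : Continuous (gsq u) := by
  have := hu.continuous_fderiv one_ne_zero
  unfold gsq
  fun_prop

theorem continuous_gdot {d : ℕ} {u w : Eu d → ℝ} (hu : ContDiff ℝ 1 u) (hw : ContDiff ℝ 1 w) :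
    Continuous (gdot u w) := by
  have := hu.continuous_fderiv one_ne_zero
  have := hw.continuous_fderiv one_ne_zero
  unfold gdot
  fun_prop

theorem continuous_laplacian {d : ℕ} {u : Eu d → ℝ} (hu : ContDiff ℝ 2 u) :
    Continuous (laplacian u) := by
  have h1 : ContDiff ℝ 1 (fderiv ℝ u) := hu.fderiv_right (by norm_num)
  have := h1.continuous_fderiv one_ne_zero
  unfold laplacian
  fun_prop

theorem gsq_eq_zero {d : ℕ} {u : Eu d → ℝ} {x : Eu d} (hx : x ∉ tsupport u) : gsq u x = 0 := by
  have : fderiv ℝ u x = 0 := by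
    by_contra h
    exact hx (support_fderiv_subset ℝ h)
  simp [gsq, this]

theorem gsq_compact {d : ℕ} {u : Eu d → ℝ} (hu : HasCompactSupport u) :
    HasCompactSupport (gsq u) :=
  HasCompactSupport.intro hu fun _ hx => gsq_eq_zero hx

/-- integration by parts -/
theorem ibp {d : ℕ} {g s : Eu d → ℝ} (hg : ContDiff ℝ 1 g) (hgc : HasCompactSupport g)
    (hs : ContDiff ℝ 2 s) : ∫ x, g x * laplacian s x = - ∫ x, gdot g s x := by
  have h1 : ContDiff ℝ 1 (fderiv ℝ s) := hs.fderiv_right (by norm_num)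
  have hc1 := h1.continuous
  have hc2 := h1.continuous_fderiv one_ne_zero
  have hc3 := hg.continuous_fderiv one_ne_zero
  have hc4 := hg.continuous
  have key : ∀ i : Fin d, ∫ x, g x * fderiv ℝ (fderiv ℝ s) x (ee i) (ee i)
      = - ∫ x, fderiv ℝ g x (ee i) * fderiv ℝ s x (ee i) := by
    intro i
    have hd : ∀ x, fderiv ℝ (fderiv ℝ s) x (ee i) (ee i)
        = fderiv ℝ (fun x => fderiv ℝ s x (ee i)) x (ee i) := by
      intro x
      rw [fderiv_clm_apply (h1.differentiable one_ne_zero x) (by fun_prop)]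
      simp
    simp_rw [hd]
    have hcd : ContDiff ℝ 1 (fun x => fderiv ℝ s x (ee i)) := h1.clm_apply contDiff_const
    have hc5 := hcd.continuous_fderiv one_ne_zero
    apply integral_mul_fderiv_eq_neg_fderiv_mul_of_integrable
    · apply Continuous.integrable_of_hasCompactSupport (by fun_prop)
      exact (hgc.fderiv_apply ℝ (ee i)).mul_right
    · apply Continuous.integrable_of_hasCompactSupport (by fun_prop)
      exact hgc.mul_right
    · apply Continuous.integrable_of_hasCompactSupport (by fun_prop)
      exact hgc.mul_right
    · exact fun x _ => hg.differentiable one_ne_zero x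
    · exact fun x _ => hcd.differentiable one_ne_zero x
  unfold laplacian gdot
  simp_rw [Finset.mul_sum]
  rw [integral_finsetSum, integral_finsetSum, ← Finset.sum_neg_distrib]
  · exact Finset.sum_congr rfl fun i _ => key i
  · intro i _
    apply Continuous.integrable_of_hasCompactSupport (by fun_prop)
    exact (hgc.fderiv_apply ℝ (ee i)).mul_right
  · intro i _
    apply Continuous.integrable_of_hasCompactSupport (by fun_prop)
    exact hgc.mul_right

/-- energy identity -/
theorem energy {d : ℕ} {z s : Eu d → ℝ} (hz : ContDiff ℝ 1 z) (hzc : HasCompactSupport z)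
    (hs : ContDiff ℝ 2 s) :
    ∫ x, (z x)^2 * s x * (- laplacian s x) =
      (∫ x, gsq (fun x => z x * s x) x) - ∫ x, gsq z x * (s x)^2 := by
  have hs1 : ContDiff ℝ 1 s := hs.of_le (by norm_num)
  have hzs : ContDiff ℝ 1 (fun x => z x * s x) := hz.mul hs1
  have hzz : ContDiff ℝ 1 (fun x => (z x)^2 * s x) := (hz.pow 2).mul hs1
  have hzsc : HasCompactSupport (fun x => z x * s x) := hzc.mul_right
  have hzzc : HasCompactSupport (fun x => (z x)^2 * s x) := by
    refine HasCompactSupport.intro hzc fun x hx => ?_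
    simp [image_eq_zero_of_notMem_tsupport hx]
  have h := ibp hzz hzzc hs
  rw [← integral_sub]
  · simp_rw [mul_neg, integral_neg]
    rw [h, neg_neg]
    refine integral_congr_ae (Eventually.of_forall fun x => ?_)
    have dz := hz.differentiable one_ne_zero x
    have ds := hs1.differentiable one_ne_zero x
    simp only
    rw [gsq_mul dz ds]
    unfold gsq gdot
    have : ∀ i : Fin d, fderiv ℝ (fun x => z x ^ 2 * s x) x (ee i)
        = (z x)^2 * fderiv ℝ s x (ee i) + 2 * z x * s x * fderiv ℝ z x (ee i) := by
      intro i
      rw [fderiv_fun_mul (dz.fun_pow 2) ds, fderiv_fun_pow 2 dz]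
      simp
      ring
    simp_rw [this]
    rw [Finset.mul_sum, Finset.mul_sum, ← Finset.sum_add_distrib]
    rw [mul_comm (∑ i, _) (s x ^2), add_sub_cancel_right]
    refine Finset.sum_congr rfl fun i _ => ?_
    ring
  · exact (continuous_gsq hzs).integrable_of_hasCompactSupport (gsq_compact hzsc)
  · have := continuous_gsq hz
    have := hs.continuous
    exact Continuous.integrable_of_hasCompactSupport (by fun_prop) ((gsq_compact hzc).mul_right)

theorem gsq_congr {d : ℕ} {u w : Eu d → ℝ} {x : Eu d} (h : u =ᶠ[nhds x] w) :
    gsq u x = gsq w x := by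
  unfold gsq; rw [h.fderiv_eq]

theorem laplacian_congr {d : ℕ} {u w : Eu d → ℝ} {x : Eu d} (h : u =ᶠ[nhds x] w) :
    laplacian u x = laplacian w x := by
  unfold laplacian; rw [h.fderiv.fderiv_eq]

/-- easy direction, on one ball -/
theorem easy_ball {d : ℕ} {V v : Eu d → ℝ} (hV : Continuous V) {y : Eu d} {r l : ℝ}
    (hv : ContDiffOn ℝ 2 v (ball y r))
    (heq : ∀ x ∈ ball y r, -laplacian v x + gsq v x + l = V x)
    {u : Eu d → ℝ} (hu : ContDiff ℝ (⊤ : ℕ∞) u) (huc : HasCompactSupport u)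
    (hus : tsupport u ⊆ ball y r) :
    l * ∫ x, (u x)^2 ≤ ∫ x, (gsq u x + V x * (u x)^2) := by
  obtain ⟨r1, hr1, hs1⟩ := exists_lt_subset_ball (isClosed_tsupport u) hus
  have hs1 : tsupport u ⊆ ball y (max r1 (r/2)) := hs1.trans (ball_subset_ball (le_max_left _ _))
  rcases le_or_gt r 0 with hr0 | hr0
  · have : u = 0 := by
      rw [ball_eq_empty.2 hr0] at hus
      ext x
      exact image_eq_zero_of_notMem_tsupport fun h => hus h
    subst this
    simp [gsq]
  set ρ := max r1 (r/2) with hρ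
  have hρ0 : 0 < ρ := lt_of_lt_of_le (by linarith) (le_max_right _ _)
  have hρr : ρ < r := max_lt hr1 (by linarith)
  let χ : ContDiffBump y := ⟨ρ, (ρ+r)/2, hρ0, by linarith⟩
  have hχs : tsupport χ ⊆ ball y r := by
    rw [χ.tsupport_eq]
    exact closedBall_subset_ball (by simp [χ]; linarith)
  let w : Eu d → ℝ := fun x => χ x * v x
  have hw : ContDiff ℝ 2 w := by
    rw [contDiff_iff_contDiffAt]
    intro x
    by_cases hx : x ∈ ball y r
    · exact χ.contDiff.contDiffAt.mul (hv.contDiffAt (isOpen_ball.mem_nhds hx))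
    · have hx' : x ∉ tsupport χ := fun h => hx (hχs h)
      have : w =ᶠ[nhds x] fun _ => 0 := by
        filter_upwards [(isClosed_tsupport χ).isOpen_compl.mem_nhds hx'] with z hz
        simp [w, image_eq_zero_of_notMem_tsupport hz]
      exact contDiffAt_const.congr_of_eventuallyEq this
  have hwv : ∀ x ∈ tsupport u, w =ᶠ[nhds x] v := by
    intro x hx
    filter_upwards [isOpen_ball.mem_nhds (hs1 hx)] with z hz
    simp [w, χ.one_of_mem_closedBall (ball_subset_closedBall hz)]
  have hu1 : ContDiff ℝ 1 u := hu.of_le (by exact_mod_cast le_top)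
  have hw1 : ContDiff ℝ 1 w := hw.of_le (by norm_num)
  have c1 := hu.continuous
  have c2 := continuous_gsq hu1
  have c3 := continuous_gsq hw1
  have c4 := continuous_laplacian hw
  have c5 := continuous_gdot hu1 hw1
  have hu2 : ContDiff ℝ 1 (fun x => u x ^ 2) := hu1.pow 2
  have hu2c : HasCompactSupport (fun x => u x ^ 2) :=
    HasCompactSupport.intro huc fun x hx => by simp [image_eq_zero_of_notMem_tsupport hx]
  have c6 := continuous_gdot hu2 hw1
  have I := ibp hu2 hu2c hw
  have hgd : ∀ x, gdot (fun x => u x ^ 2) w x = 2 * u x * gdot u w x := by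
    intro x
    unfold gdot
    rw [Finset.mul_sum]
    refine Finset.sum_congr rfl fun i _ => ?_
    rw [fderiv_fun_pow 2 (hu1.differentiable one_ne_zero x)]
    simp
    ring
  have hpt : ∀ x, gsq u x + V x * (u x)^2 - l * (u x)^2 =
      - (u x ^ 2 * laplacian w x) - gdot (fun x => u x ^ 2) w x
        + ∑ i, (fderiv ℝ u x (ee i) + u x * fderiv ℝ w x (ee i))^2 := by
    intro x
    rw [hgd]
    have h2 : ∑ i, (fderiv ℝ u x (ee i) + u x * fderiv ℝ w x (ee i))^2
        = gsq u x + 2 * u x * gdot u w x + (u x)^2 * gsq w x := by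
      unfold gsq gdot
      rw [Finset.mul_sum, Finset.mul_sum, ← Finset.sum_add_distrib, ← Finset.sum_add_distrib]
      refine Finset.sum_congr rfl fun i _ => ?_
      ring
    rw [h2]
    by_cases hx : x ∈ tsupport u
    · have e := heq x (hus hx)
      rw [laplacian_congr (hwv x hx), gsq_congr (hwv x hx), ← e]
      ring
    · have h0 := image_eq_zero_of_notMem_tsupport hx
      simp [h0]
  have i1 : Integrable fun x => gsq u x + V x * (u x)^2 := by
    refine Continuous.integrable_of_hasCompactSupport (by fun_prop) ?_
    exact (gsq_compact huc).add hu2c.mul_left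
  have i2 : Integrable fun x => l * (u x)^2 :=
    Continuous.integrable_of_hasCompactSupport (by fun_prop) hu2c.mul_left
  have i3 : Integrable fun x => u x ^ 2 * laplacian w x :=
    Continuous.integrable_of_hasCompactSupport (by fun_prop) hu2c.mul_right
  have i4 : Integrable (gdot (fun x => u x ^ 2) w) := by
    refine c6.integrable_of_hasCompactSupport ?_
    refine HasCompactSupport.intro huc fun x hx => ?_
    simp [hgd, image_eq_zero_of_notMem_tsupport hx]
  have i34 : Integrable fun x => - (u x ^ 2 * laplacian w x) - gdot (fun x => u x ^ 2) w x :=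
    i3.neg.sub i4
  have h0 : ∫ x, (- (u x ^ 2 * laplacian w x) - gdot (fun x => u x ^ 2) w x) = 0 := by
    rw [integral_sub i3.fun_neg i4, integral_neg, I]
    ring
  have hle : ∫ x, (- (u x ^ 2 * laplacian w x) - gdot (fun x => u x ^ 2) w x)
      ≤ ∫ x, (gsq u x + V x * (u x)^2 - l * (u x)^2) := by
    refine integral_mono i34 (i1.sub i2) fun x => ?_
    simp only [hpt x]
    have : 0 ≤ ∑ i, (fderiv ℝ u x (ee i) + u x * fderiv ℝ w x (ee i))^2 :=
      Finset.sum_nonneg fun _ _ => sq_nonneg _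
    linarith
  rw [h0, integral_sub i1 i2, integral_const_mul] at hle
  linarith


theorem ims {d : ℕ} {r : ℝ} (hr : 0 < r) : ∃ C : ℝ, ∀ (U : Eu d → ℝ), Continuous U → ∀ b : ℝ,
    (∀ z : Eu d, ∀ u : Eu d → ℝ, ContDiff ℝ (⊤ : ℕ∞) u → HasCompactSupport u →
      tsupport u ⊆ ball z r → b * ∫ x, (u x)^2 ≤ ∫ x, (gsq u x + U x * (u x)^2)) →
    ∀ u : Eu d → ℝ, ContDiff ℝ (⊤ : ℕ∞) u → HasCompactSupport u →
      (b - C) * ∫ x, (u x)^2 ≤ ∫ x, (gsq u x + U x * (u x)^2) := by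
  let χ : ContDiffBump (0 : Eu d) := ⟨r/4, r/2, by linarith, by linarith⟩
  have hχ : ContDiff ℝ (⊤ : ℕ∞) χ := χ.contDiff
  have hχ1 : ContDiff ℝ 1 χ := hχ.of_le (by exact_mod_cast le_top)
  have hχc : HasCompactSupport χ := χ.hasCompactSupport
  have cχ := hχ.continuous
  have cχ' := hχ1.continuous_fderiv one_ne_zero
  have cgχ := continuous_gsq hχ1
  have hχsqc : HasCompactSupport (fun x => χ x ^ 2) :=
    HasCompactSupport.intro hχc fun x hx => by simp [image_eq_zero_of_notMem_tsupport hx]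
  set N := ∫ x, (χ x)^2 with hN
  have hNpos : 0 < N := by
    refine Continuous.integral_pos_of_hasCompactSupport_nonneg_nonzero (x := 0) (by fun_prop) hχsqc
      (fun x => sq_nonneg _) ?_
    have := χ.pos_of_mem_ball (x := 0) (mem_ball_self χ.rOut_pos)
    positivity
  set D := ∫ x, gsq χ x with hD
  refine ⟨D / N, fun U hU b hyp φ hφ hφc => ?_⟩
  have hφ1 : ContDiff ℝ 1 φ := hφ.of_le (by exact_mod_cast le_top)
  have cφ := hφ.continuous
  have cφ' := hφ1.continuous_fderiv one_ne_zero
  have cgφ := continuous_gsq hφ1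
  let J : Eu d → Eu d → ℝ := fun z x => χ (x - z)^2 * (gsq φ x + (U x - b) * φ x ^ 2)
    + 2 * φ x * (∑ i, fderiv ℝ φ x (ee i) * (χ (x - z) * fderiv ℝ χ (x - z) (ee i)))
    + φ x ^ 2 * gsq χ (x - z)
  have hJc : Continuous J.uncurry := by
    unfold J Function.uncurry
    fun_prop
  have hJ0 : ∀ z x, (x ∉ tsupport φ ∨ x - z ∉ tsupport χ) → J z x = 0 := by
    rintro z x (h | h)
    · simp [J, image_eq_zero_of_notMem_tsupport h, gsq_eq_zero h]
    · simp [J, image_eq_zero_of_notMem_tsupport h, gsq_eq_zero h]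
  have hJs : HasCompactSupport J.uncurry := by
    refine HasCompactSupport.intro
      (K := (fun q : Eu d × Eu d => (q.1 - q.2, q.1)) '' (tsupport φ ×ˢ tsupport χ)) ?_ ?_
    · exact (hφc.isCompact.prod hχc.isCompact).image (by fun_prop)
    · rintro ⟨z, x⟩ h
      refine hJ0 z x ?_
      by_contra! hh
      exact h ⟨(x, x - z), ⟨hh.1, hh.2⟩, by simp⟩
  have hφsqc : HasCompactSupport (fun x => φ x ^ 2) :=
    HasCompactSupport.intro hφc fun x hx => by simp [image_eq_zero_of_notMem_tsupport hx]
  -- lower bound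
  have h1 : ∀ z, 0 ≤ ∫ x, J z x := by
    intro z
    let ψ : Eu d → ℝ := fun x => χ (x - z) * φ x
    have hτ : ContDiff ℝ (⊤ : ℕ∞) (fun x => χ (x - z)) := hχ.comp (contDiff_id.sub contDiff_const)
    have hτ1 : ContDiff ℝ 1 (fun x => χ (x - z)) := hτ.of_le (by exact_mod_cast le_top)
    have hψ : ContDiff ℝ (⊤ : ℕ∞) ψ := hτ.mul hφ
    have hψ1 : ContDiff ℝ 1 ψ := hψ.of_le (by exact_mod_cast le_top)
    have hψc : HasCompactSupport ψ := hφc.mul_left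
    have hψsqc : HasCompactSupport (fun x => ψ x ^ 2) :=
      HasCompactSupport.intro hψc fun x hx => by simp [image_eq_zero_of_notMem_tsupport hx]
    have hψs : tsupport ψ ⊆ ball z r := by
      refine (closure_minimal ?_ isClosed_closedBall).trans
        (closedBall_subset_ball (show r/2 < r by linarith))
      intro x hx
      have : χ (x - z) ≠ 0 := fun h => hx (by simp [ψ, h])
      have : x - z ∈ Function.support χ := this
      rw [χ.support_eq] at this
      simp only [mem_ball, dist_zero_right] at this
      rw [mem_closedBall, dist_eq_norm]
      exact this.le
    have H := hyp z ψ hψ hψc hψs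
    have cψ := hψ.continuous
    have cgψ := continuous_gsq hψ1
    have i1 : Integrable fun x => gsq ψ x + U x * (ψ x)^2 := by
      refine Continuous.integrable_of_hasCompactSupport (by fun_prop) ?_
      exact (gsq_compact hψc).add hψsqc.mul_left
    have i2 : Integrable fun x => b * (ψ x)^2 :=
      Continuous.integrable_of_hasCompactSupport (by fun_prop) hψsqc.mul_left
    have hJe : ∀ x, J z x = (gsq ψ x + U x * (ψ x)^2) - b * (ψ x)^2 := by
      intro x
      have e := gsq_mul (hτ1.differentiable one_ne_zero x) (hφ1.differentiable one_ne_zero x)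
      have e1 : fderiv ℝ (fun x => χ (x - z)) x = fderiv ℝ χ (x - z) := by
        rw [fderiv_comp_sub]
      have e2 : gsq (fun x => χ (x - z)) x = gsq χ (x - z) := by
        unfold gsq; rw [e1]
      have e3 : gdot (fun x => χ (x - z)) φ x =
          ∑ i, fderiv ℝ χ (x - z) (ee i) * fderiv ℝ φ x (ee i) := by
        unfold gdot; rw [e1]
      have e4 : ∑ i, fderiv ℝ φ x (ee i) * (χ (x - z) * fderiv ℝ χ (x - z) (ee i))
          = χ (x - z) * gdot (fun x => χ (x - z)) φ x := by
        rw [e3, Finset.mul_sum]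
        refine Finset.sum_congr rfl fun i _ => ?_
        ring
      simp only [J, ψ]
      rw [e, e4, e2]
      ring
    simp_rw [hJe]
    rw [integral_sub i1 i2, integral_const_mul]
    linarith
  have h2 : 0 ≤ ∫ z, ∫ x, J z x := integral_nonneg h1
  rw [integral_integral_swap_of_hasCompactSupport hJc hJs] at h2
  have hodd : ∀ i : Fin d, ∫ w, χ w * fderiv ℝ χ w (ee i) = 0 := by
    intro i
    have : ∫ w, χ w * fderiv ℝ χ w (ee i) = - ∫ w, fderiv ℝ χ w (ee i) * χ w := by
      apply integral_mul_fderiv_eq_neg_fderiv_mul_of_integrable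
      · exact Continuous.integrable_of_hasCompactSupport (by fun_prop) hχc.mul_left
      · exact Continuous.integrable_of_hasCompactSupport (by fun_prop) hχc.mul_right
      · exact Continuous.integrable_of_hasCompactSupport (by fun_prop) hχc.mul_right
      · exact fun x _ => hχ1.differentiable one_ne_zero x
      · exact fun x _ => hχ1.differentiable one_ne_zero x
    simp_rw [mul_comm (fderiv ℝ χ _ _)] at this
    linarith
  have h3 : ∀ x, ∫ z, J z x = N * (gsq φ x + (U x - b) * φ x ^ 2) + φ x ^ 2 * D := by
    intro x
    have : ∫ z, J z x = ∫ w, (χ w^2 * (gsq φ x + (U x - b) * φ x ^ 2)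
      + 2 * φ x * (∑ i, fderiv ℝ φ x (ee i) * (χ w * fderiv ℝ χ w (ee i)))
      + φ x ^ 2 * gsq χ w) :=
      integral_sub_left_eq_self (fun w => χ w^2 * (gsq φ x + (U x - b) * φ x ^ 2)
      + 2 * φ x * (∑ i, fderiv ℝ φ x (ee i) * (χ w * fderiv ℝ χ w (ee i)))
      + φ x ^ 2 * gsq χ w) volume x
    rw [this]
    have j1 : Integrable fun w => χ w^2 * (gsq φ x + (U x - b) * φ x ^ 2) :=
      Continuous.integrable_of_hasCompactSupport (by fun_prop) hχsqc.mul_right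
    have j20 : ∀ i : Fin d, Integrable fun w =>
        fderiv ℝ φ x (ee i) * (χ w * fderiv ℝ χ w (ee i)) := fun i =>
      Continuous.integrable_of_hasCompactSupport (by fun_prop)
        (HasCompactSupport.mul_left (hχc.mul_right))
    have j2 : Integrable fun w => 2 * φ x *
        (∑ i, fderiv ℝ φ x (ee i) * (χ w * fderiv ℝ χ w (ee i))) :=
      (integrable_finsetSum _ fun i _ => j20 i).const_mul _
    have j3 : Integrable fun w => φ x ^ 2 * gsq χ w :=
      Continuous.integrable_of_hasCompactSupport (by fun_prop) (gsq_compact hχc).mul_left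
    rw [integral_add (j1.fun_add j2) j3, integral_add j1 j2, integral_mul_const, integral_const_mul,
      integral_const_mul, integral_finsetSum _ fun i _ => j20 i]
    simp_rw [integral_const_mul, hodd]
    simp [hN, hD]
  simp_rw [h3] at h2
  have i1 : Integrable fun x => gsq φ x + U x * (φ x)^2 := by
    refine Continuous.integrable_of_hasCompactSupport (by fun_prop) ?_
    exact (gsq_compact hφc).add hφsqc.mul_left
  have i2 : Integrable fun x => (φ x)^2 :=
    Continuous.integrable_of_hasCompactSupport (by fun_prop) hφsqc
  have h4 : ∫ x, (N * (gsq φ x + (U x - b) * φ x ^ 2) + φ x ^ 2 * D)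
      = N * ((∫ x, (gsq φ x + U x * (φ x)^2)) - (b - D/N) * ∫ x, (φ x)^2) := by
    rw [← integral_const_mul, ← integral_sub i1 (i2.const_mul _), ← integral_const_mul]
    congr 1
    ext x
    field_simp
    ring
  rw [h4] at h2
  have := nonneg_of_mul_nonneg_right h2 hNpos
  linarith

open scoped Convolution in
theorem form_C1 {d : ℕ} {U : Eu d → ℝ} (hU : Continuous U) {b : ℝ}
    (hyp : ∀ u : Eu d → ℝ, ContDiff ℝ (⊤ : ℕ∞) u → HasCompactSupport u →
      b * ∫ x, (u x)^2 ≤ ∫ x, (gsq u x + U x * (u x)^2))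
    {φ : Eu d → ℝ} (hφ1 : ContDiff ℝ 1 φ) (hφc : HasCompactSupport φ) :
    b * ∫ x, (φ x)^2 ≤ ∫ x, (gsq φ x + U x * (φ x)^2) := by
  have cφ := hφ1.continuous
  have cφ' := hφ1.continuous_fderiv one_ne_zero
  have cgφ := continuous_gsq hφ1
  let η : ℕ → ContDiffBump (0 : Eu d) := fun n =>
    ⟨1/(n+2), 1/(n+1), by positivity, by gcongr; norm_num⟩
  have hη1 : ∀ n, (η n).rOut ≤ 1 := by
    intro n
    simp only [η]
    rw [div_le_one (by positivity)]
    linarith [Nat.cast_nonneg (α := ℝ) n]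
  have hη : Tendsto (fun n => (η n).rOut) atTop (nhds 0) := tendsto_one_div_add_atTop_nhds_zero_nat
  let M : (Eu d → ℝ) → ℕ → Eu d → ℝ := fun g n =>
    ((η n).normed volume ⋆[ContinuousLinearMap.lsmul ℝ ℝ, volume] g)
  obtain ⟨ρ, hρ⟩ := hφc.isCompact.isBounded.subset_closedBall (0 : Eu d)
  -- facts about mollification
  have hout : ∀ g : Eu d → ℝ, (∀ x, x ∉ tsupport φ → g x = 0) →
      ∀ n x, x ∉ closedBall (0 : Eu d) (ρ + 1) → M g n x = 0 := by
    intro g hg n x hx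
    have hz : ∀ y ∈ ball x (η n).rOut, g y = 0 := by
      intro y hy
      apply hg
      intro hy2
      apply hx
      have h1 := hρ hy2
      rw [mem_closedBall] at *
      rw [mem_ball] at hy
      have := dist_triangle x y 0
      rw [dist_comm x y] at this
      linarith [hη1 n]
    have hxx : g x = 0 := hz x (mem_ball_self (η n).rOut_pos)
    have := ContDiffBump.normed_convolution_eq_right (φ := η n) (μ := volume) (g := g) (x₀ := x)
      (fun y hy => by rw [hz y hy, hxx])
    exact this.trans hxx
  have hbd : ∀ g : Eu d → ℝ, Continuous g → HasCompactSupport g →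
      ∃ B, ∀ n x, |M g n x| ≤ B := by
    intro g hg hgc
    obtain ⟨B, hB⟩ := hgc.exists_bound_of_continuous hg
    refine ⟨3 * B, fun n x => ?_⟩
    have := ContDiffBump.dist_normed_convolution_le (φ := η n) (μ := volume) (g := g) (x₀ := x)
      (ε := 2 * B) hg.aestronglyMeasurable (fun y hy => by
        have := dist_le_norm_add_norm (g y) (g x)
        linarith [hB y, hB x])
    have h2 : |M g n x| ≤ |M g n x - g x| + |g x| := by
      have := abs_add_le (M g n x - g x) (g x)
      simpa using this
    rw [Real.dist_eq] at this
    have h3 := hB x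
    rw [Real.norm_eq_abs] at h3
    change |M g n x - g x| ≤ _ at this
    linarith
  have hlim : ∀ g : Eu d → ℝ, Continuous g → ∀ x, Tendsto (fun n => M g n x) atTop (nhds (g x)) :=
    fun g hg x => ContDiffBump.convolution_tendsto_right_of_continuous hη hg x
  have hli : ∀ n, LocallyIntegrable ((η n).normed volume) (volume : Measure (Eu d)) := fun n =>
    (η n).continuous_normed.locallyIntegrable
  have hMs : ∀ n, ContDiff ℝ (⊤ : ℕ∞) (M φ n) := fun n =>
    (η n).hasCompactSupport_normed.contDiff_convolution_left _ (η n).contDiff_normed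
      cφ.locallyIntegrable
  have hMd : ∀ n x i, fderiv ℝ (M φ n) x (ee i) = M (fun x => fderiv ℝ φ x (ee i)) n x := by
    intro n x i
    have h1 := hφc.hasFDerivAt_convolution_right (ContinuousLinearMap.lsmul ℝ ℝ) (hli n) hφ1 x
    have h2 : fderiv ℝ (M φ n) x = _ := h1.fderiv
    rw [h2, convolution_precompR_apply _ (hli n) (hφc.fderiv ℝ) cφ']
  have hMc : ∀ n, HasCompactSupport (M φ n) := fun n =>
    HasCompactSupport.intro (isCompact_closedBall (0 : Eu d) (ρ+1))
      (hout φ (fun x hx => image_eq_zero_of_notMem_tsupport hx) n)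
  have hfz : ∀ i x, x ∉ tsupport φ → fderiv ℝ φ x (ee i) = 0 := by
    intro i x hx
    have : fderiv ℝ φ x = 0 := by
      by_contra h
      exact hx (support_fderiv_subset ℝ h)
    simp [this]
  obtain ⟨B0, hB0⟩ := hbd φ cφ hφc
  have hbi : ∀ i : Fin d, ∃ B, ∀ n x, |M (fun x => fderiv ℝ φ x (ee i)) n x| ≤ B := fun i =>
    hbd _ (by fun_prop) (hφc.fderiv_apply ℝ (ee i))
  choose B1 hB1 using hbi
  let K : Set (Eu d) := closedBall 0 (ρ+1)
  let bound : Eu d → ℝ := K.indicator fun x => (∑ i, B1 i ^ 2) + |U x - b| * B0 ^ 2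
  have hbound : Integrable bound := by
    rw [integrable_indicator_iff isClosed_closedBall.measurableSet]
    exact (by fun_prop : Continuous fun x => (∑ i, B1 i ^ 2) + |U x - b| * B0 ^ 2).continuousOn
      |>.integrableOn_compact (isCompact_closedBall _ _)
  have hT : Tendsto (fun n => ∫ x, (gsq (M φ n) x + (U x - b) * (M φ n x)^2)) atTop
      (nhds (∫ x, (gsq φ x + (U x - b) * (φ x)^2))) := by
    refine tendsto_integral_of_dominated_convergence bound ?_ hbound ?_ ?_
    · intro n
      have := continuous_gsq ((hMs n).of_le (by exact_mod_cast le_top) : ContDiff ℝ 1 (M φ n))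
      have := (hMs n).continuous
      exact Continuous.aestronglyMeasurable (by fun_prop)
    · intro n
      refine Eventually.of_forall fun x => ?_
      by_cases hx : x ∈ K
      · simp only [bound, Set.indicator_of_mem hx]
        have h1 : |gsq (M φ n) x| ≤ ∑ i, B1 i ^ 2 := by
          rw [abs_of_nonneg (gsq_nonneg _ _)]
          unfold gsq
          refine Finset.sum_le_sum fun i _ => ?_
          rw [hMd]
          exact sq_le_sq.2 ((hB1 i n x).trans (le_abs_self _))
        have h2 : (M φ n x)^2 ≤ B0^2 := sq_le_sq.2 ((hB0 n x).trans (le_abs_self _))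
        rw [Real.norm_eq_abs]
        refine (abs_add_le _ _).trans (add_le_add h1 ?_)
        rw [abs_mul, abs_of_nonneg (sq_nonneg (M φ n x))]
        gcongr
      · have h1 : M φ n x = 0 := hout φ (fun x hx => image_eq_zero_of_notMem_tsupport hx) n x hx
        have h2 : gsq (M φ n) x = 0 := by
          unfold gsq
          refine Finset.sum_eq_zero fun i _ => ?_
          rw [hMd, hout _ (hfz i) n x hx]
          simp
        simp [h1, h2, bound, hx]
    · refine Eventually.of_forall fun x => ?_
      refine Tendsto.add ?_ (((hlim φ cφ x).pow 2).const_mul _)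
      unfold gsq
      refine tendsto_finsetSum _ fun i _ => ?_
      simp_rw [hMd]
      exact (hlim _ (by fun_prop) x).pow 2
  have hsplit : ∀ ψ : Eu d → ℝ, ContDiff ℝ 1 ψ → HasCompactSupport ψ →
      ∫ x, (gsq ψ x + (U x - b) * (ψ x)^2) =
        (∫ x, (gsq ψ x + U x * (ψ x)^2)) - b * ∫ x, (ψ x)^2 := by
    intro ψ hψ hψc
    have c1 := hψ.continuous
    have c2 := continuous_gsq hψ
    have hψsqc : HasCompactSupport (fun x => ψ x ^ 2) :=
      HasCompactSupport.intro hψc fun x hx => by simp [image_eq_zero_of_notMem_tsupport hx]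
    rw [← integral_const_mul, ← integral_sub]
    · congr 1; ext x; ring
    · refine Continuous.integrable_of_hasCompactSupport (by fun_prop) ?_
      exact (gsq_compact hψc).add hψsqc.mul_left
    · exact Continuous.integrable_of_hasCompactSupport (by fun_prop) hψsqc.mul_left
  have hge : 0 ≤ ∫ x, (gsq φ x + (U x - b) * (φ x)^2) := by
    refine ge_of_tendsto' hT fun n => ?_
    rw [hsplit _ ((hMs n).of_le (by exact_mod_cast le_top)) (hMc n)]
    linarith [hyp _ (hMs n) (hMc n)]
  rw [hsplit φ hφ1 hφc] at hge
  linarith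

set_option maxSynthPendingDepth 3

/-- inner product as a bilinear continuous map -/
noncomputable def BB (d : ℕ) : Eu d →L[ℝ] Eu d →L[ℝ] ℝ :=
  LinearMap.mkContinuous₂ (innerₗ (Eu d)) 1 (fun x y => by
    simpa using norm_inner_le_norm (𝕜 := ℝ) x y)

theorem BB_apply {d : ℕ} (x y : Eu d) : BB d x y = inner ℝ x y := rfl

theorem BB_norm {d : ℕ} : ‖BB d‖ ≤ 1 := LinearMap.mkContinuous₂_norm_le _ zero_le_one _

theorem BB_norm_apply {d : ℕ} (x : Eu d) : ‖BB d x‖ ≤ ‖x‖ := by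
  have := (BB d).le_opNorm x
  nlinarith [BB_norm (d := d), norm_nonneg x]

/-- heat kernel -/
noncomputable def HK {d : ℕ} (t : ℝ) (x : Eu d) : ℝ :=
  (4 * Real.pi * t) ^ (-(d : ℝ) / 2) * Real.exp (-(‖x‖ ^ 2) / (4 * t))

noncomputable def HK1 {d : ℕ} (t : ℝ) (x : Eu d) : Eu d →L[ℝ] ℝ :=
  HK t x • ((-(1 / (2 * t))) • BB d x)

noncomputable def HK2 {d : ℕ} (t : ℝ) (x : Eu d) : Eu d →L[ℝ] Eu d →L[ℝ] ℝ :=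
  HK t x • ((1 / (4 * t ^ 2)) • (BB d x).smulRight (BB d x) - (1 / (2 * t)) • BB d)

noncomputable def HKt {d : ℕ} (t : ℝ) (x : Eu d) : ℝ :=
  HK t x * (‖x‖ ^ 2 / (4 * t ^ 2) - d / (2 * t))

theorem HK_pos {d : ℕ} {t : ℝ} (ht : 0 < t) (x : Eu d) : 0 < HK t x := by
  unfold HK; positivity

theorem HK_le {d : ℕ} {t : ℝ} (ht : 0 < t) (x : Eu d) :
    HK t x ≤ (4 * Real.pi * t) ^ (-(d : ℝ) / 2) := by
  unfold HK
  have h : Real.exp (-(‖x‖ ^ 2) / (4 * t)) ≤ 1 := by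
    rw [Real.exp_le_one_iff]
    have : 0 ≤ ‖x‖^2 / (4*t) := by positivity
    rw [neg_div]; linarith
  have : 0 ≤ (4 * Real.pi * t) ^ (-(d : ℝ) / 2) := by positivity
  nlinarith

theorem HK_hasFDerivAt {d : ℕ} {t : ℝ} (x : Eu d) :
    HasFDerivAt (HK t) (HK1 t x) x := by
  have h1 : HasFDerivAt (fun x : Eu d => ‖x‖^2) (2 • innerSL ℝ x) x :=
    (hasStrictFDerivAt_norm_sq x).hasFDerivAt
  have h2 := (((h1.neg).mul_const (4*t)⁻¹).exp).const_mul ((4 * Real.pi * t) ^ (-(d : ℝ) / 2))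
  unfold HK
  refine (h2.congr_fderiv ?_)
  ext y
  simp [HK1, HK, BB_apply, div_eq_mul_inv]
  ring

theorem HK1_hasFDerivAt {d : ℕ} {t : ℝ} (x : Eu d) :
    HasFDerivAt (HK1 t) (HK2 t x) x := by
  have h1 : HasFDerivAt (fun x : Eu d => (-(1 / (2 * t))) • BB d x) ((-(1 / (2 * t))) • BB d) x :=
    ((BB d).hasFDerivAt).fun_const_smul _
  have h2 := (HK_hasFDerivAt (t := t) x).smul h1
  refine (h2.congr_fderiv ?_)
  ext y z
  simp [HK2, HK1, BB_apply]
  ring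

theorem HK_hasDerivAt {d : ℕ} {t : ℝ} (ht : 0 < t) (x : Eu d) :
    HasDerivAt (fun t => HK t x) (HKt t x) t := by
  unfold HK
  have h1 : HasDerivAt (fun t : ℝ => 4 * Real.pi * t) (4 * Real.pi) t := by
    simpa using (hasDerivAt_id t).const_mul (4 * Real.pi)
  have h2 := h1.rpow_const (p := -(d:ℝ)/2) (Or.inl (by positivity))
  have h3 : HasDerivAt (fun t : ℝ => -(‖x‖ ^ 2) / (4 * t)) (‖x‖^2 / (4 * t^2)) t := by
    have := ((hasDerivAt_id t).const_mul 4).fun_inv (by simpa using ht.ne') |>.const_mul (-(‖x‖^2))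
    simp only [div_eq_mul_inv]
    refine this.congr_deriv ?_
    simp
    field_simp
  refine (h2.mul h3.exp).congr_deriv ?_
  unfold HKt HK
  rw [Real.rpow_sub_one (by positivity)]
  field_simp
  ring

theorem HK2_trace {d : ℕ} {t : ℝ} (x : Eu d) :
    ∑ i, HK2 t x (ee i) (ee i) = HKt t x := by
  have : ∀ i : Fin d, HK2 t x (ee i) (ee i) =
      HK t x * (1 / (4 * t^2) * (x i)^2 - 1/(2*t)) := by
    intro i
    simp only [HK2, BB_apply, EuclideanSpace.inner_single_right, ContinuousLinearMap.smul_apply,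
      ContinuousLinearMap.sub_apply, ContinuousLinearMap.smulRight_apply, smul_eq_mul]
    simp
    left; ring_nf; try simp
  simp_rw [this]
  rw [← Finset.mul_sum, Finset.sum_sub_distrib, ← Finset.mul_sum]
  have h2 : ‖x‖^2 = ∑ i, (x i)^2 := by
    rw [EuclideanSpace.norm_sq_eq]; simp
  unfold HKt
  rw [← h2]
  simp
  left; ring

theorem HK_integrable {d : ℕ} {t : ℝ} (ht : 0 < t) : Integrable (HK (d := d) t) := by
  have h0 : ∫ x : Eu d, Real.exp (-(1/(4*t)) * ‖x‖^2) ≠ 0 := by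
    rw [GaussianFourier.integral_rexp_neg_mul_sq_norm (by positivity)]
    positivity
  have h1 : Integrable fun x : Eu d => Real.exp (-(1/(4*t)) * ‖x‖^2) := by
    by_contra h
    exact h0 (integral_undef h)
  have h2 := h1.const_mul ((4 * Real.pi * t) ^ (-(d : ℝ) / 2))
  refine h2.congr (Eventually.of_forall fun x => ?_)
  simp only [HK]
  congr 2
  ring

theorem HK_integral {d : ℕ} {t : ℝ} (ht : 0 < t) : ∫ x : Eu d, HK t x = 1 := by
  have h1 := GaussianFourier.integral_rexp_neg_mul_sq_norm (V := Eu d) (b := 1/(4*t))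
    (by positivity)
  have : ∀ x : Eu d, HK t x =
      (4 * Real.pi * t) ^ (-(d : ℝ) / 2) * Real.exp (-(1/(4*t)) * ‖x‖^2) := by
    intro x
    simp only [HK]
    congr 2
    ring
  simp_rw [this]
  rw [integral_const_mul, h1]
  have e : Real.pi / (1/(4*t)) = 4 * Real.pi * t := by field_simp
  rw [e, ← Real.rpow_add (by positivity)]
  simp
  rw [show -(d:ℝ)/2 + d/2 = 0 by ring]
  simp

theorem HK_double {d : ℕ} {t : ℝ} (ht : 0 < t) (x : Eu d) :
    HK t x = 2 ^ ((d:ℝ)/2) * HK (2*t) x * Real.exp (-(‖x‖^2/(8*t))) := by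
  unfold HK
  have e : 4 * Real.pi * (2*t) = 2 * (4 * Real.pi * t) := by ring
  rw [e, Real.mul_rpow (x := 2) (y := 4 * Real.pi * t) (by norm_num) (by positivity)]
  have e2 : -(‖x‖ ^ 2) / (4 * t) = -(‖x‖ ^ 2) / (4 * (2*t)) + -(‖x‖^2/(8*t)) := by
    field_simp; ring
  rw [e2, Real.exp_add]
  have e3 : (2:ℝ) ^ ((d:ℝ)/2) * 2 ^ (-(d:ℝ)/2) = 1 := by
    rw [← Real.rpow_add (by norm_num)]
    rw [show (d:ℝ)/2 + -(d:ℝ)/2 = 0 by ring]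
    simp
  linear_combination (-(4 * Real.pi * t) ^ (-(d:ℝ)/2) * Real.exp (-‖x‖ ^ 2 / (4 * (2 * t)))
    * Real.exp (-(‖x‖ ^ 2 / (8 * t)))) * e3

theorem poly_exp (q : ℝ) (hq : 0 ≤ q) : (1 + q) * (2 + q ^ 2) ≤ 100 * Real.exp (q^2/8) := by
  have h := Real.quadratic_le_exp_of_nonneg (show 0 ≤ q^2/8 by positivity)
  have h2 : (1 + q) * (2 + q ^ 2) ≤ 100 * (1 + q^2/8 + (q^2/8)^2/2) := by
    nlinarith [sq_nonneg (q-1), sq_nonneg (q^2 - q), sq_nonneg (q^2-1), sq_nonneg q]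
  linarith

/-- master bound: `(1+q)(2+q²) HK t ≤ C HK 2t` with `q = ‖x‖/√t` -/
theorem HK_master {d : ℕ} {t : ℝ} (ht : 0 < t) (x : Eu d) :
    (1 + ‖x‖ / √t) * (2 + ‖x‖^2 / t) * HK t x ≤ 100 * 2 ^ ((d:ℝ)/2) * HK (2*t) x := by
  have h := poly_exp (‖x‖/√t) (by positivity)
  have e : (‖x‖/√t)^2 = ‖x‖^2/t := by
    rw [div_pow, Real.sq_sqrt ht.le]
  rw [e] at h
  have e2 : ‖x‖^2/t/8 = ‖x‖^2/(8*t) := by field_simp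
  rw [e2] at h
  rw [HK_double ht x]
  have hp := HK_pos (d := d) (show 0 < 2*t by positivity) x
  calc (1 + ‖x‖ / √t) * (2 + ‖x‖^2 / t) * (2 ^ ((d:ℝ)/2) * HK (2*t) x * Real.exp (-(‖x‖^2/(8*t))))
      ≤ (100 * Real.exp (‖x‖^2/(8*t))) *
        (2 ^ ((d:ℝ)/2) * HK (2*t) x * Real.exp (-(‖x‖^2/(8*t)))) := by
        gcongr
    _ = 100 * 2 ^ ((d:ℝ)/2) * HK (2*t) x *
        (Real.exp (‖x‖^2/(8*t)) * Real.exp (-(‖x‖^2/(8*t)))) := by ring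
    _ = _ := by rw [← Real.exp_add]; simp

/-- the constant -/
noncomputable def CK (d : ℕ) : ℝ := (d + 1) * (100 * 2 ^ ((d:ℝ)/2))

theorem CK_pos (d : ℕ) : 0 < CK d := by unfold CK; positivity

theorem HK1_bound {d : ℕ} {t : ℝ} (ht : 0 < t) (x : Eu d) :
    ‖HK1 t x‖ ≤ CK d * t ^ (-(1/2) : ℝ) * HK (2*t) x := by
  have hm := HK_master ht x
  have hp := HK_pos ht x
  have hp2 := HK_pos (d := d) (show 0 < 2*t by positivity) x
  have h1 : ‖HK1 t x‖ ≤ HK t x * (1/(2*t) * ‖x‖) := by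
    unfold HK1
    rw [norm_smul, norm_smul, Real.norm_of_nonneg hp.le, norm_neg,
      Real.norm_of_nonneg (by positivity)]
    gcongr
    exact BB_norm_apply x
  have e : t ^ (-(1/2) : ℝ) = (√t)⁻¹ := by
    rw [Real.rpow_neg ht.le, ← Real.sqrt_eq_rpow]
  have hs : 0 < √t := by positivity
  have e2 : 1/(2*t) * ‖x‖ = (√t)⁻¹ * (1/2 * (‖x‖/√t)) := by
    have : t = √t * √t := (Real.mul_self_sqrt ht.le).symm
    conv_lhs => rw [this]
    field_simp
  rw [e]
  refine h1.trans ?_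
  rw [e2]
  have h3 : 1/2 * (‖x‖/√t) ≤ (1 + ‖x‖ / √t) * (2 + ‖x‖^2 / t) := by
    have a : 0 ≤ ‖x‖/√t := by positivity
    have b : 0 ≤ ‖x‖^2 / t := by positivity
    nlinarith [mul_nonneg a b]
  have h4 : 100 * 2 ^ ((d:ℝ)/2) ≤ CK d := by
    unfold CK
    have : (0:ℝ) ≤ d := Nat.cast_nonneg d
    have : (0:ℝ) < 100 * 2 ^ ((d:ℝ)/2) := by positivity
    nlinarith
  calc HK t x * ((√t)⁻¹ * (1/2 * (‖x‖/√t)))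
      ≤ HK t x * ((√t)⁻¹ * ((1 + ‖x‖ / √t) * (2 + ‖x‖^2 / t))) := by gcongr
    _ = (√t)⁻¹ * ((1 + ‖x‖ / √t) * (2 + ‖x‖^2 / t) * HK t x) := by ring
    _ ≤ (√t)⁻¹ * (CK d * HK (2*t) x) := by gcongr ?_ * ?_; exact hm.trans (by gcongr)
    _ = _ := by ring

theorem HK2_norm {d : ℕ} {t : ℝ} (ht : 0 < t) (x : Eu d) :
    ‖HK2 t x‖ ≤ HK t x * (t⁻¹ * (2 + ‖x‖^2/t)) := by
  have hp := HK_pos ht x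
  unfold HK2
  rw [norm_smul, Real.norm_of_nonneg hp.le]
  gcongr
  refine (norm_sub_le _ _).trans ?_
  rw [norm_smul, norm_smul, Real.norm_of_nonneg (by positivity),
    Real.norm_of_nonneg (by positivity), ContinuousLinearMap.norm_smulRight_apply]
  have h1 : ‖BB d x‖ * ‖BB d x‖ ≤ ‖x‖^2 := by
    rw [sq]; gcongr <;> exact BB_norm_apply x
  have h2 := BB_norm (d := d)
  calc 1 / (4*t^2) * (‖BB d x‖ * ‖BB d x‖) + 1/(2*t) * ‖BB d‖
      ≤ 1 / (4*t^2) * ‖x‖^2 + 1/(2*t) * 1 := by gcongr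
    _ = t⁻¹ * (1/2 + (‖x‖^2/t)/4) := by field_simp; ring
    _ ≤ _ := by
      have b : 0 ≤ ‖x‖^2 / t := by positivity
      refine mul_le_mul_of_nonneg_left ?_ (by positivity)
      linarith

theorem HK2_bound {d : ℕ} {t α : ℝ} (ht : 0 < t) (hα : 0 ≤ α) (hα1 : α ≤ 1) (x : Eu d) :
    ‖x‖ ^ α * ‖HK2 t x‖ ≤ CK d * t ^ (α/2 - 1) * HK (2*t) x := by
  have hm := HK_master ht x
  have hp := HK_pos ht x
  have hp2 := HK_pos (d := d) (show 0 < 2*t by positivity) x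
  have hs : 0 < √t := by positivity
  have h1 : ‖x‖^α ≤ (1 + ‖x‖/√t) * t^(α/2) := by
    have e : ‖x‖ = (‖x‖/√t) * √t := by field_simp
    have e1 : ‖x‖^α = (‖x‖/√t)^α * t^(α/2) := by
      conv_lhs => rw [e, Real.mul_rpow (by positivity) hs.le]
      rw [Real.sqrt_eq_rpow, ← Real.rpow_mul ht.le]
      congr 2; ring
    rw [e1]
    gcongr
    have a : 0 ≤ ‖x‖/√t := by positivity
    calc (‖x‖/√t)^α ≤ (1 + ‖x‖/√t)^α := by gcongr; linarith
      _ ≤ (1 + ‖x‖/√t)^(1:ℝ) := Real.rpow_le_rpow_of_exponent_le (by linarith) hα1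
      _ = _ := by simp
  have h4 : 100 * 2 ^ ((d:ℝ)/2) ≤ CK d := by
    unfold CK
    have : (0:ℝ) ≤ d := Nat.cast_nonneg d
    have : (0:ℝ) < 100 * 2 ^ ((d:ℝ)/2) := by positivity
    nlinarith
  calc ‖x‖ ^ α * ‖HK2 t x‖ ≤ ((1 + ‖x‖/√t) * t^(α/2)) * (HK t x * (t⁻¹ * (2 + ‖x‖^2/t))) := by
        gcongr
        exact HK2_norm ht x
    _ = (t^(α/2) * t⁻¹) * ((1 + ‖x‖ / √t) * (2 + ‖x‖^2 / t) * HK t x) := by ring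
    _ ≤ (t^(α/2) * t⁻¹) * (CK d * HK (2*t) x) := by gcongr ?_ * ?_; exact hm.trans (by gcongr)
    _ = _ := by rw [Real.rpow_sub_one ht.ne']; field_simp

theorem HKt_bound {d : ℕ} {t : ℝ} (ht : 0 < t) (x : Eu d) :
    |HKt t x| ≤ CK d * t⁻¹ * HK (2*t) x := by
  have hm := HK_master ht x
  have hp := HK_pos ht x
  have hp2 := HK_pos (d := d) (show 0 < 2*t by positivity) x
  have hs : 0 < √t := by positivity
  unfold HKt
  rw [abs_mul, abs_of_pos hp]
  have hd : (0:ℝ) ≤ d := Nat.cast_nonneg d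
  have a : 0 ≤ ‖x‖/√t := by positivity
  have b : 0 ≤ ‖x‖^2 / t := by positivity
  have h1 : |‖x‖ ^ 2 / (4 * t ^ 2) - d / (2 * t)| ≤ t⁻¹ * ((d+1) * (2 + ‖x‖^2/t)) := by
    have e : ‖x‖ ^ 2 / (4 * t ^ 2) - d / (2 * t) = t⁻¹ * ((‖x‖^2/t)/4 - d/2) := by field_simp
    rw [e, abs_mul, abs_of_pos (by positivity : 0 < t⁻¹)]
    gcongr
    rw [abs_le]
    constructor <;> nlinarith [mul_nonneg hd b]
  have h2 : 2 + ‖x‖^2/t ≤ (1 + ‖x‖ / √t) * (2 + ‖x‖^2 / t) := by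
    nlinarith [mul_nonneg a b]
  calc HK t x * |‖x‖ ^ 2 / (4 * t ^ 2) - d / (2 * t)|
      ≤ HK t x * (t⁻¹ * ((d+1) * ((1 + ‖x‖ / √t) * (2 + ‖x‖^2 / t)))) := by
        gcongr; exact h1.trans (by gcongr)
    _ = t⁻¹ * (d+1) * ((1 + ‖x‖ / √t) * (2 + ‖x‖^2 / t) * HK t x) := by ring
    _ ≤ t⁻¹ * (d+1) * (100 * 2 ^ ((d:ℝ)/2) * HK (2*t) x) := by gcongr
    _ = _ := by unfold CK; ring

theorem HK_continuous {d : ℕ} {t : ℝ} : Continuous (HK (d := d) t) := by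
  unfold HK; fun_prop

theorem HK1_continuous {d : ℕ} {t : ℝ} : Continuous (HK1 (d := d) t) := by
  have := HK_continuous (d := d) (t := t)
  unfold HK1; fun_prop

theorem HK2_continuous {d : ℕ} {t : ℝ} : Continuous (HK2 (d := d) t) := by
  have h := HK_continuous (d := d) (t := t)
  have : Continuous fun x => (BB d x).smulRight (BB d x) :=
    ((ContinuousLinearMap.smulRightL ℝ (Eu d) (Eu d →L[ℝ] ℝ)).continuous.comp
      (BB d).continuous).clm_apply (BB d).continuous
  unfold HK2
  fun_prop

theorem HKt_continuous {d : ℕ} {t : ℝ} : Continuous (HKt (d := d) t) := by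
  have := HK_continuous (d := d) (t := t)
  unfold HKt; fun_prop

theorem HK_measurable {d : ℕ} : Measurable fun q : ℝ × Eu d => HK q.1 q.2 := by
  unfold HK; fun_prop

theorem HK1_measurable {d : ℕ} : StronglyMeasurable fun q : ℝ × Eu d => HK1 q.1 q.2 := by
  have h1 := (HK_measurable (d := d)).stronglyMeasurable
  have h2 : StronglyMeasurable fun q : ℝ × Eu d => -(1/(2*q.1)) :=
    Measurable.stronglyMeasurable (by fun_prop)
  have h3 : StronglyMeasurable fun q : ℝ × Eu d => BB d q.2 :=
    Continuous.stronglyMeasurable (by fun_prop)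
  exact h1.smul (h2.smul h3)

theorem HK2_measurable {d : ℕ} : StronglyMeasurable fun q : ℝ × Eu d => HK2 q.1 q.2 := by
  have h1 := (HK_measurable (d := d)).stronglyMeasurable
  have h2 : StronglyMeasurable fun q : ℝ × Eu d => (1/(2*q.1)) :=
    Measurable.stronglyMeasurable (by fun_prop)
  have h4 : StronglyMeasurable fun q : ℝ × Eu d => (1/(4*q.1^2)) :=
    Measurable.stronglyMeasurable (by fun_prop)
  have h3 : StronglyMeasurable fun q : ℝ × Eu d => (BB d q.2).smulRight (BB d q.2) := by
    have : Continuous fun x => (BB d x).smulRight (BB d x) :=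
      ((ContinuousLinearMap.smulRightL ℝ (Eu d) (Eu d →L[ℝ] ℝ)).continuous.comp
        (BB d).continuous).clm_apply (BB d).continuous
    exact (this.comp continuous_snd).stronglyMeasurable
  exact h1.smul ((h4.smul h3).sub (h2.smul stronglyMeasurable_const))

theorem HK1_integrable {d : ℕ} {t : ℝ} (ht : 0 < t) : Integrable (HK1 (d := d) t) := by
  refine ((HK_integrable (d := d) (show 0 < 2*t by positivity)).const_mul
    (CK d * t ^ (-(1/2) : ℝ))).mono' HK1_continuous.aestronglyMeasurable
    (Eventually.of_forall fun x => HK1_bound ht x)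

theorem HK2_bound0 {d : ℕ} {t : ℝ} (ht : 0 < t) (x : Eu d) :
    ‖HK2 t x‖ ≤ CK d * t⁻¹ * HK (2*t) x := by
  have := HK2_bound ht le_rfl zero_le_one x
  simpa [Real.rpow_neg_one] using this

theorem HK2_integrable {d : ℕ} {t : ℝ} (ht : 0 < t) : Integrable (HK2 (d := d) t) := by
  refine ((HK_integrable (d := d) (show 0 < 2*t by positivity)).const_mul
    (CK d * t⁻¹)).mono' HK2_continuous.aestronglyMeasurable
    (Eventually.of_forall fun x => HK2_bound0 ht x)

theorem HK2_integral {d : ℕ} {t : ℝ} (ht : 0 < t) : ∫ x : Eu d, HK2 t x = 0 := by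
  have hi := HK2_integrable (d := d) ht
  ext y : 1
  rw [ContinuousLinearMap.integral_apply hi]
  have e : ∀ x, HK2 (d := d) t x = fderiv ℝ (HK1 t) x := fun x => (HK1_hasFDerivAt x).fderiv.symm
  have hd : Differentiable ℝ (HK1 (d := d) t) := fun x => (HK1_hasFDerivAt x).differentiableAt
  have := integral_smul_fderiv_eq_neg_fderiv_smul_of_integrable (𝕜 := ℝ) (μ := volume)
    (f := fun _ : Eu d => (1:ℝ)) (g := HK1 (d := d) t) (v := y) (by simp) (by
      simp only [one_smul, ← e]
      exact hi.apply_continuousLinearMap y) (by simpa using HK1_integrable ht)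
    (fun x _ => by fun_prop) (fun x _ => hd x)
  simpa [← e] using this


section conv
variable {d : ℕ} {E : Type*} [NormedAddCommGroup E] [NormedSpace ℝ E]

/-- convolution of a vector valued kernel with a scalar function -/
noncomputable def cv (K : Eu d → E) (F : Eu d → ℝ) (x : Eu d) : E := ∫ y, F y • K (x - y)

/-- bounded, integrable, measurable functions -/
structure GF (F : Eu d → ℝ) (B : ℝ) : Prop where
  meas : Measurable F
  int : Integrable F
  bd : ∀ x, |F x| ≤ B

theorem GF.B_nonneg {F : Eu d → ℝ} {B : ℝ} (h : GF F B) : 0 ≤ B := (abs_nonneg _).trans (h.bd 0)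

theorem cv_meas {K : Eu d → E} {F : Eu d → ℝ} (hF : Integrable F) (hK : Continuous K)
    (x : Eu d) : AEStronglyMeasurable (fun y => F y • K (x - y)) volume :=
  hF.aestronglyMeasurable.smul (hK.comp (continuous_const.sub continuous_id)).aestronglyMeasurable

theorem cv_integrable {K : Eu d → E} {F : Eu d → ℝ} {C : ℝ} (hF : Integrable F)
    (hK : Continuous K) (hC : ∀ w, ‖K w‖ ≤ C) (x : Eu d) :
    Integrable (fun y => F y • K (x - y)) := by
  refine (hF.norm.mul_const C).mono' (cv_meas hF hK x) (Eventually.of_forall fun y => ?_)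
  rw [norm_smul]
  gcongr
  exact hC _

theorem cv_continuous {K : Eu d → E} {F : Eu d → ℝ} {C : ℝ} (hF : Integrable F)
    (hK : Continuous K) (hC : ∀ w, ‖K w‖ ≤ C) : Continuous (cv K F) := by
  refine continuous_of_dominated (fun x => cv_meas hF hK x)
    (bound := fun y => ‖F y‖ * C) (fun x => Eventually.of_forall fun y => ?_)
    (hF.norm.mul_const C) (Eventually.of_forall fun y => ?_)
  · rw [norm_smul]; gcongr; exact hC _
  · exact (hK.comp (continuous_id.sub continuous_const)).const_smul _

theorem cv_hasFDerivAt {K : Eu d → E} {K' : Eu d → Eu d →L[ℝ] E} {F : Eu d → ℝ} {C C' : ℝ}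
    (hF : Integrable F) (hK : ∀ w, HasFDerivAt K (K' w) w) (hC : ∀ w, ‖K w‖ ≤ C)
    (hK' : Continuous K') (hC' : ∀ w, ‖K' w‖ ≤ C') (x : Eu d) :
    HasFDerivAt (cv K F) (cv K' F x) x := by
  have hKc : Continuous K := continuous_iff_continuousAt.2 fun w => (hK w).continuousAt
  refine hasFDerivAt_integral_of_dominated_of_fderiv_le (s := Set.univ)
    (F' := fun x y => F y • K' (x - y)) (bound := fun y => ‖F y‖ * C') univ_mem
    (Eventually.of_forall fun x => cv_meas hF hKc x) (cv_integrable hF hKc hC x)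
    (cv_meas hF hK' x) (Eventually.of_forall fun y x _ => ?_) (hF.norm.mul_const C')
    (Eventually.of_forall fun y x _ => ?_)
  · rw [norm_smul]; gcongr; exact hC' _
  · have h := (hK (x - y)).comp x ((hasFDerivAt_id x).sub_const y)
    exact h.const_smul (F y)

theorem cv_bound {K : Eu d → E} {F : Eu d → ℝ} {C s B : ℝ} (hs : 0 < s) (hF : GF F B)
    (hK : ∀ w, ‖K w‖ ≤ C * HK s w) (x : Eu d) : ‖cv K F x‖ ≤ C * B := by
  have hi : Integrable fun y => B * (C * HK s (x - y)) :=
    (((HK_integrable hs).comp_sub_left x).const_mul C).const_mul B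
  refine (norm_integral_le_of_norm_le hi (Eventually.of_forall fun y => ?_)).trans ?_
  · rw [norm_smul]
    exact mul_le_mul (hF.bd y) (hK _) (norm_nonneg _) hF.B_nonneg
  · rw [integral_const_mul, integral_const_mul, integral_sub_left_eq_self (HK s) volume x,
      HK_integral hs]
    apply le_of_eq; ring

theorem cv_holder [CompleteSpace E] {K : Eu d → E} {F : Eu d → ℝ} {C s B A α : ℝ} (hs : 0 < s) (hF : GF F B)
    (hKc : Continuous K) (hKi : Integrable K) {C0 : ℝ} (hC0 : ∀ w, ‖K w‖ ≤ C0)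
    (hK : ∀ w, ‖w‖ ^ α * ‖K w‖ ≤ C * HK s w) (hA0 : 0 ≤ A)
    (hA : ∀ x y, |F y - F x| ≤ A * ‖y - x‖ ^ α)
    (x : Eu d) : ‖cv K F x - F x • ∫ w, K w‖ ≤ A * C := by
  have e : cv K F x - F x • ∫ w, K w = ∫ y, (F y - F x) • K (x - y) := by
    rw [← integral_sub_left_eq_self K volume x, ← integral_smul, cv, ← integral_sub]
    · simp_rw [sub_smul]
    · exact cv_integrable hF.int hKc hC0 x
    · exact (hKi.comp_sub_left x).smul (F x)
  rw [e]
  have hi : Integrable fun y => A * (C * HK s (x - y)) :=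
    (((HK_integrable hs).comp_sub_left x).const_mul C).const_mul A
  refine (norm_integral_le_of_norm_le hi (Eventually.of_forall fun y => ?_)).trans ?_
  · rw [norm_smul]
    calc ‖F y - F x‖ * ‖K (x - y)‖ ≤ A * ‖y - x‖ ^ α * ‖K (x - y)‖ := by gcongr; exact hA x y
      _ = A * (‖x - y‖ ^ α * ‖K (x - y)‖) := by rw [norm_sub_rev]; ring
      _ ≤ _ := mul_le_mul_of_nonneg_left (hK _) hA0
  · rw [integral_const_mul, integral_const_mul, integral_sub_left_eq_self (HK s) volume x,
      HK_integral hs]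
    apply le_of_eq; ring

/-- joint measurability -/
theorem cv_smeas {K : ℝ → Eu d → E} {F : Eu d → ℝ} (hF : Measurable F)
    (hK : StronglyMeasurable fun q : ℝ × Eu d => K q.1 q.2) :
    StronglyMeasurable fun q : ℝ × Eu d => cv (K q.1) F q.2 := by
  unfold cv
  have h1 : Measurable fun q : (ℝ × Eu d) × Eu d => ((q.1.1, q.1.2 - q.2) : ℝ × Eu d) := by
    fun_prop
  have h2 : StronglyMeasurable fun q : (ℝ × Eu d) × Eu d => F q.2 • K q.1.1 (q.1.2 - q.2) :=
    (hF.comp measurable_snd).stronglyMeasurable.smul (hK.comp_measurable h1)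
  exact h2.integral_prod_right'

theorem cv_smeas_t {K : ℝ → Eu d → E} {F : Eu d → ℝ} (hF : Measurable F)
    (hK : StronglyMeasurable fun q : ℝ × Eu d => K q.1 q.2) (x : Eu d) :
    StronglyMeasurable fun t : ℝ => cv (K t) F x :=
  (cv_smeas hF hK).comp_measurable (measurable_id.prodMk measurable_const)

/-! time integrals -/

theorem wt_integrable {s : ℝ} (hs : 0 < s) (A : ℝ) :
    IntegrableOn (fun t : ℝ => A * (Real.exp (-t) * t ^ (s - 1))) (Set.Ioi 0) :=
  (Real.GammaIntegral_convergent hs).const_mul A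

theorem wt_bound {L t A s : ℝ} (hL : 1 ≤ L) (ht : 0 < t) {g : E} (hg : ‖g‖ ≤ A * t ^ (s - 1)) :
    ‖Real.exp (-(L * t)) • g‖ ≤ A * (Real.exp (-t) * t ^ (s - 1)) := by
  rw [norm_smul, Real.norm_of_nonneg (Real.exp_pos _).le]
  have : Real.exp (-(L*t)) ≤ Real.exp (-t) := by
    apply Real.exp_le_exp.2; nlinarith
  calc _ ≤ Real.exp (-t) * (A * t ^ (s - 1)) := by gcongr
    _ = _ := by ring

theorem tm_meas {L : ℝ} {g : ℝ → E} (hg : StronglyMeasurable g) :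
    AEStronglyMeasurable (fun t => Real.exp (-(L * t)) • g t) (volume.restrict (Set.Ioi 0)) := by
  have : Continuous fun t => Real.exp (-(L*t)) := by fun_prop
  exact (this.stronglyMeasurable.smul hg).aestronglyMeasurable

theorem tm_integrable {L A s : ℝ} (hL : 1 ≤ L) (hs : 0 < s) {g : ℝ → E}
    (hg : StronglyMeasurable g) (hb : ∀ t, 0 < t → ‖g t‖ ≤ A * t ^ (s - 1)) :
    IntegrableOn (fun t => Real.exp (-(L * t)) • g t) (Set.Ioi 0) := by
  refine (wt_integrable hs A).mono' (tm_meas hg) ?_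
  filter_upwards [ae_restrict_mem measurableSet_Ioi] with t ht
  exact wt_bound hL ht (hb t ht)

/-- time integral -/
noncomputable def TI (L : ℝ) (G : ℝ → Eu d → E) (x : Eu d) : E :=
  ∫ t in Set.Ioi 0, Real.exp (-(L * t)) • G t x

theorem TI_continuous {L A s : ℝ} (hL : 1 ≤ L) (hs : 0 < s) {G : ℝ → Eu d → E}
    (hg : ∀ x, StronglyMeasurable fun t => G t x)
    (hb : ∀ t x, 0 < t → ‖G t x‖ ≤ A * t ^ (s - 1))
    (hc : ∀ t, 0 < t → Continuous (G t)) : Continuous (TI L G) := by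
  refine continuous_of_dominated (fun x => tm_meas (hg x))
    (bound := fun t => A * (Real.exp (-t) * t ^ (s - 1))) (fun x => ?_) (wt_integrable hs A) ?_
  · filter_upwards [ae_restrict_mem measurableSet_Ioi] with t ht
    exact wt_bound hL ht (hb t x ht)
  · filter_upwards [ae_restrict_mem measurableSet_Ioi] with t ht
    exact (hc t ht).const_smul _

theorem TI_hasFDerivAt {L A s A' s' : ℝ} (hL : 1 ≤ L) (hs : 0 < s) (hs' : 0 < s')
    {G : ℝ → Eu d → E} {G' : ℝ → Eu d → Eu d →L[ℝ] E}
    (hg : ∀ x, StronglyMeasurable fun t => G t x)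
    (hg' : ∀ x, StronglyMeasurable fun t => G' t x)
    (hb : ∀ t x, 0 < t → ‖G t x‖ ≤ A * t ^ (s - 1))
    (hb' : ∀ t x, 0 < t → ‖G' t x‖ ≤ A' * t ^ (s' - 1))
    (hd : ∀ t x, 0 < t → HasFDerivAt (G t) (G' t x) x) (x : Eu d) :
    HasFDerivAt (TI L G) (TI L G' x) x := by
  refine hasFDerivAt_integral_of_dominated_of_fderiv_le (s := Set.univ)
    (F' := fun x t => Real.exp (-(L * t)) • G' t x)
    (bound := fun t => A' * (Real.exp (-t) * t ^ (s' - 1))) univ_mem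
    (Eventually.of_forall fun x => tm_meas (hg x))
    (tm_integrable hL hs (hg x) (fun t ht => hb t x ht)) (tm_meas (hg' x)) ?_
    (wt_integrable hs' A') ?_
  · filter_upwards [ae_restrict_mem measurableSet_Ioi] with t ht x _
    exact wt_bound hL ht (hb' t x ht)
  · filter_upwards [ae_restrict_mem measurableSet_Ioi] with t ht x _
    exact (hd t x ht).const_smul _

theorem TI_norm {L A s : ℝ} (hL : 1 ≤ L) (hs : 0 < s) {G : ℝ → Eu d → E}
    (hb : ∀ t x, 0 < t → ‖G t x‖ ≤ A * t ^ (s - 1)) (x : Eu d) :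
    ‖TI L G x‖ ≤ A * Real.Gamma s := by
  rw [Real.Gamma_eq_integral hs, ← integral_const_mul]
  refine norm_integral_le_of_norm_le (wt_integrable hs A) ?_
  filter_upwards [ae_restrict_mem measurableSet_Ioi] with t ht
  exact wt_bound hL ht (hb t x ht)

end conv

set_option linter.unusedVariables false

section resolvent
variable {d : ℕ}

theorem HK_norm_bd {t : ℝ} (ht : 0 < t) (w : Eu d) :
    ‖HK t w‖ ≤ (4 * Real.pi * t) ^ (-(d : ℝ) / 2) := by
  rw [Real.norm_of_nonneg (HK_pos ht w).le]; exact HK_le ht w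

theorem HK1_norm_bd {t : ℝ} (ht : 0 < t) (w : Eu d) :
    ‖HK1 t w‖ ≤ CK d * t ^ (-(1/2) : ℝ) * (4 * Real.pi * (2*t)) ^ (-(d : ℝ) / 2) := by
  refine (HK1_bound ht w).trans ?_
  have := CK_pos d
  gcongr
  exact HK_le (by positivity) w

theorem HK2_norm_bd {t : ℝ} (ht : 0 < t) (w : Eu d) :
    ‖HK2 t w‖ ≤ CK d * t⁻¹ * (4 * Real.pi * (2*t)) ^ (-(d : ℝ) / 2) := by
  refine (HK2_bound0 ht w).trans ?_
  have := CK_pos d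
  gcongr
  exact HK_le (by positivity) w

theorem HKt_norm_bd {t : ℝ} (ht : 0 < t) (w : Eu d) :
    ‖HKt t w‖ ≤ CK d * t⁻¹ * (4 * Real.pi * (2*t)) ^ (-(d : ℝ) / 2) := by
  refine (HKt_bound ht w).trans ?_
  have := CK_pos d
  gcongr
  exact HK_le (by positivity) w

/-- resolvent -/
noncomputable def RR (L : ℝ) (F : Eu d → ℝ) : Eu d → ℝ := TI L fun t => cv (HK t) F
noncomputable def RR1 (L : ℝ) (F : Eu d → ℝ) : Eu d → Eu d →L[ℝ] ℝ := TI L fun t => cv (HK1 t) F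
noncomputable def RR2 (L : ℝ) (F : Eu d → ℝ) : Eu d → Eu d →L[ℝ] Eu d →L[ℝ] ℝ :=
  TI L fun t => cv (HK2 t) F

theorem HK_sm : StronglyMeasurable fun q : ℝ × Eu d => HK q.1 q.2 :=
  HK_measurable.stronglyMeasurable

theorem h0_bound {F : Eu d → ℝ} {B t : ℝ} (hF : GF F B) (ht : 0 < t) (x : Eu d) :
    ‖cv (HK t) F x‖ ≤ B * t ^ ((1:ℝ) - 1) := by
  have := cv_bound (C := 1) ht hF (K := HK t) (fun w => by
    rw [Real.norm_of_nonneg (HK_pos ht w).le, one_mul]) x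
  simpa using this

theorem h1_bound {F : Eu d → ℝ} {B t : ℝ} (hF : GF F B) (ht : 0 < t) (x : Eu d) :
    ‖cv (HK1 t) F x‖ ≤ CK d * B * t ^ ((1/2:ℝ) - 1) := by
  have := cv_bound (s := 2*t) (by positivity) hF (K := HK1 t) (fun w => HK1_bound ht w) x
  refine this.trans (le_of_eq ?_)
  norm_num; ring

theorem h2_bound {F : Eu d → ℝ} {B t A α : ℝ} (hF : GF F B) (ht : 0 < t)
    (hα : 0 ≤ α) (hα1 : α ≤ 1) (hA0 : 0 ≤ A) (hA : ∀ x y, |F y - F x| ≤ A * ‖y - x‖ ^ α)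
    (x : Eu d) :
    ‖cv (HK2 t) F x‖ ≤ A * CK d * t ^ (α/2 - 1) := by
  have := cv_holder (s := 2*t) (by positivity) hF (K := HK2 t) HK2_continuous (HK2_integrable ht)
    (HK2_norm_bd ht) (fun w => HK2_bound ht hα hα1 w) hA0 hA x
  rw [HK2_integral ht, smul_zero, sub_zero] at this
  refine this.trans (le_of_eq ?_)
  ring

theorem RR_hasFDerivAt {F : Eu d → ℝ} {B L : ℝ} (hL : 1 ≤ L) (hF : GF F B) (x : Eu d) :
    HasFDerivAt (RR L F) (RR1 L F x) x :=
  TI_hasFDerivAt hL one_pos one_half_pos (fun x => cv_smeas_t hF.meas HK_sm x)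
    (fun x => cv_smeas_t hF.meas HK1_measurable x) (fun t x ht => h0_bound hF ht x)
    (fun t x ht => h1_bound hF ht x)
    (fun t x ht => cv_hasFDerivAt hF.int HK_hasFDerivAt (HK_norm_bd ht) HK1_continuous
      (HK1_norm_bd ht) x) x

theorem RR1_hasFDerivAt {F : Eu d → ℝ} {B L A α : ℝ} (hL : 1 ≤ L) (hF : GF F B)
    (hα : 0 < α) (hα1 : α ≤ 1) (hA0 : 0 ≤ A) (hA : ∀ x y, |F y - F x| ≤ A * ‖y - x‖ ^ α)
    (x : Eu d) :
    HasFDerivAt (RR1 L F) (RR2 L F x) x :=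
  TI_hasFDerivAt hL one_half_pos (half_pos hα) (fun x => cv_smeas_t hF.meas HK1_measurable x)
    (fun x => cv_smeas_t hF.meas HK2_measurable x)
    (fun t x ht => h1_bound hF ht x) (fun t x ht => h2_bound hF ht hα.le hα1 hA0 hA x)
    (fun t x ht => cv_hasFDerivAt hF.int HK1_hasFDerivAt (HK1_norm_bd ht) HK2_continuous
      (HK2_norm_bd ht) x) x

theorem RR2_continuous {F : Eu d → ℝ} {B L A α : ℝ} (hL : 1 ≤ L) (hF : GF F B)
    (hα : 0 < α) (hα1 : α ≤ 1) (hA0 : 0 ≤ A) (hA : ∀ x y, |F y - F x| ≤ A * ‖y - x‖ ^ α) :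
    Continuous (RR2 L F) :=
  TI_continuous hL (half_pos hα) (fun x => cv_smeas_t hF.meas HK2_measurable x)
    (fun t x ht => h2_bound hF ht hα.le hα1 hA0 hA x)
    (fun t ht => cv_continuous hF.int HK2_continuous (HK2_norm_bd ht))

theorem RR_C2 {F : Eu d → ℝ} {B L A α : ℝ} (hL : 1 ≤ L) (hF : GF F B)
    (hα : 0 < α) (hα1 : α ≤ 1) (hA0 : 0 ≤ A) (hA : ∀ x y, |F y - F x| ≤ A * ‖y - x‖ ^ α) :
    ContDiff ℝ 2 (RR L F) := by
  have e1 : fderiv ℝ (RR L F) = RR1 L F := funext fun x => (RR_hasFDerivAt hL hF x).fderiv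
  have e2 : fderiv ℝ (RR1 L F) = RR2 L F :=
    funext fun x => (RR1_hasFDerivAt hL hF hα hα1 hA0 hA x).fderiv
  rw [show (2 : WithTop ℕ∞) = 1 + 1 by norm_num, contDiff_succ_iff_fderiv, e1,
    contDiff_one_iff_fderiv, e2]
  exact ⟨fun x => (RR_hasFDerivAt hL hF x).differentiableAt, by simp,
    fun x => (RR1_hasFDerivAt hL hF hα hα1 hA0 hA x).differentiableAt,
    RR2_continuous hL hF hα hα1 hA0 hA⟩

theorem RR_abs {F : Eu d → ℝ} {B L : ℝ} (hL : 1 ≤ L) (hF : GF F B) (x : Eu d) :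
    |RR L F x| ≤ B := by
  have := TI_norm hL one_pos (G := fun t => cv (HK t) F) (fun t x ht => h0_bound hF ht x) x
  rw [Real.Gamma_one, mul_one] at this
  exact this

theorem RR_lip {F : Eu d → ℝ} {B L : ℝ} (hL : 1 ≤ L) (hF : GF F B) (x y : Eu d) :
    |RR L F y - RR L F x| ≤ (CK d * B * Real.Gamma (1/2)) * ‖y - x‖ := by
  have h := Convex.norm_image_sub_le_of_norm_hasFDerivWithin_le (𝕜 := ℝ) (f := RR L F)
    (f' := RR1 L F) (s := Set.univ) (C := CK d * B * Real.Gamma (1/2))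
    (fun x _ => (RR_hasFDerivAt hL hF x).hasFDerivWithinAt)
    (fun x _ => TI_norm hL one_half_pos (fun t x ht => h1_bound hF ht x) x) convex_univ
    (Set.mem_univ x) (Set.mem_univ y)
  exact h

theorem RR_continuous {F : Eu d → ℝ} {B L : ℝ} (hL : 1 ≤ L) (hF : GF F B) :
    Continuous (RR L F) :=
  continuous_iff_continuousAt.2 fun x => (RR_hasFDerivAt hL hF x).continuousAt

theorem cv_HK_mono {F G : Eu d → ℝ} {t : ℝ} (ht : 0 < t) (hF : Integrable F) (hG : Integrable G)
    (h : ∀ x, F x ≤ G x) (x : Eu d) : cv (HK t) F x ≤ cv (HK t) G x := by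
  refine integral_mono (cv_integrable hF HK_continuous (HK_norm_bd ht) x)
    (cv_integrable hG HK_continuous (HK_norm_bd ht) x) fun y => ?_
  exact mul_le_mul_of_nonneg_right (h y) (HK_pos ht _).le

theorem RR_integrableOn {F : Eu d → ℝ} {B L : ℝ} (hL : 1 ≤ L) (hF : GF F B) (x : Eu d) :
    IntegrableOn (fun t => Real.exp (-(L * t)) • cv (HK t) F x) (Set.Ioi 0) :=
  tm_integrable hL one_pos (cv_smeas_t hF.meas HK_sm x) (fun t ht => h0_bound hF ht x)

theorem RR_mono {F G : Eu d → ℝ} {B B' L : ℝ} (hL : 1 ≤ L) (hF : GF F B) (hG : GF G B')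
    (h : ∀ x, F x ≤ G x) (x : Eu d) : RR L F x ≤ RR L G x := by
  refine setIntegral_mono_on (RR_integrableOn hL hF x) (RR_integrableOn hL hG x)
    measurableSet_Ioi fun t ht => ?_
  exact mul_le_mul_of_nonneg_left (cv_HK_mono ht hF.int hG.int h x) (Real.exp_pos _).le

theorem RR_nonneg {F : Eu d → ℝ} {L : ℝ} (h : ∀ x, 0 ≤ F x) (x : Eu d) : 0 ≤ RR L F x := by
  refine setIntegral_nonneg measurableSet_Ioi fun t ht => ?_
  exact mul_nonneg (Real.exp_pos _).le
    (integral_nonneg fun y => mul_nonneg (h y) (HK_pos ht _).le)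

theorem RR_pos {F : Eu d → ℝ} {B L : ℝ} (hL : 1 ≤ L) (hF : GF F B) (hFc : Continuous F)
    (h : ∀ x, 0 ≤ F x) {x0 : Eu d} (h0 : F x0 ≠ 0) (x : Eu d) : 0 < RR L F x := by
  have hcv : ∀ t, 0 < t → 0 < cv (HK t) F x := by
    intro t ht
    have hc : Continuous fun y => F y • HK t (x - y) :=
      hFc.smul (HK_continuous.comp (continuous_const.sub continuous_id))
    refine integral_pos_of_integrable_nonneg_nonzero (x := x0) hc
      (cv_integrable hF.int HK_continuous (HK_norm_bd ht) x)
      (fun y => mul_nonneg (h y) (HK_pos ht _).le) ?_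
    exact mul_ne_zero h0 (HK_pos ht _).ne'
  refine (setIntegral_pos_iff_support_of_nonneg_ae ?_ (RR_integrableOn hL hF x)).2 ?_
  · filter_upwards [ae_restrict_mem measurableSet_Ioi] with t ht
    exact mul_nonneg (Real.exp_pos _).le (hcv t ht).le
  · have : Function.support (fun t => Real.exp (-(L * t)) • cv (HK t) F x) ∩ Set.Ioi 0
        = Set.Ioi 0 := by
      refine Set.inter_eq_right.2 fun t ht => ?_
      exact mul_ne_zero (Real.exp_pos _).ne' (hcv t ht).ne'
    rw [this]
    simp

theorem RR_tau {F : Eu d → ℝ} {B L τ : ℝ} (hL : 1 ≤ L) (hF : GF F B) (h : ∀ x, 0 ≤ F x)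
    (hτ : 0 < τ) (x : Eu d) :
    RR L F x ≤ τ * B + (4 * Real.pi * τ) ^ (-(d : ℝ) / 2) * ∫ y, F y := by
  set P := (4 * Real.pi * τ) ^ (-(d : ℝ) / 2) * ∫ y, F y with hP
  have hI : 0 ≤ ∫ y, F y := integral_nonneg h
  have hP0 : 0 ≤ P := by positivity
  have hB := hF.B_nonneg
  have i1 : Integrable (Set.indicator (Set.Ioc 0 τ) fun _ => B) (volume.restrict (Set.Ioi (0:ℝ))) := by
    refine IntegrableOn.integrable_indicator ?_ measurableSet_Ioc
    refine (integrableOn_const (by simp)).mono_measure Measure.restrict_le_self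
  have i2 : IntegrableOn (fun t : ℝ => P * (Real.exp (-t) * t ^ ((1:ℝ) - 1))) (Set.Ioi 0) :=
    wt_integrable one_pos P
  have hle : RR L F x ≤ ∫ t in Set.Ioi (0:ℝ), (Set.indicator (Set.Ioc 0 τ) (fun _ => B) t
      + P * (Real.exp (-t) * t ^ ((1:ℝ) - 1))) := by
    refine setIntegral_mono_on (RR_integrableOn hL hF x) (i1.add i2) measurableSet_Ioi
      fun t ht => ?_
    have ht' : 0 < t := ht
    have hb := h0_bound hF ht' x
    have hn : 0 ≤ cv (HK t) F x := integral_nonneg fun y => mul_nonneg (h y) (HK_pos ht _).le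
    rw [Real.norm_of_nonneg hn] at hb
    simp only [sub_self, Real.rpow_zero, mul_one] at hb ⊢
    have he : Real.exp (-(L*t)) ≤ Real.exp (-t) := by
      apply Real.exp_le_exp.2; nlinarith
    have he1 : Real.exp (-t) ≤ 1 := by rw [Real.exp_le_one_iff]; linarith
    by_cases hc : t ≤ τ
    · rw [Set.indicator_of_mem (show t ∈ Set.Ioc 0 τ from ⟨ht', hc⟩)]
      have : Real.exp (-(L*t)) • cv (HK t) F x ≤ 1 * B := by
        rw [smul_eq_mul]; gcongr; exact he.trans he1
      have h3 : 0 ≤ P * Real.exp (-t) := by positivity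
      linarith
    · push Not at hc
      rw [Set.indicator_of_notMem (by simp [hc])]
      have h4 : cv (HK t) F x ≤ P := by
        rw [hP, ← integral_const_mul]
        refine integral_mono (cv_integrable hF.int HK_continuous (HK_norm_bd ht) x)
          (hF.int.const_mul _) fun y => ?_
        rw [smul_eq_mul, mul_comm]
        refine mul_le_mul_of_nonneg_right ?_ (h y)
        refine (HK_le ht' _).trans ?_
        refine Real.rpow_le_rpow_of_nonpos (by positivity) (by gcongr) ?_
        have : (0:ℝ) ≤ d := Nat.cast_nonneg d
        linarith
      rw [smul_eq_mul, zero_add, mul_comm P]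
      gcongr
  refine hle.trans (le_of_eq ?_)
  rw [integral_add i1 i2, integral_const_mul, ← Real.Gamma_eq_integral one_pos, Real.Gamma_one,
    mul_one, integral_indicator measurableSet_Ioc, Measure.restrict_restrict measurableSet_Ioc,
    Set.inter_eq_left.2 Set.Ioc_subset_Ioi_self]
  simp [hτ.le]

theorem RR_tendsto {F : ℕ → Eu d → ℝ} {F' G : Eu d → ℝ} {B L : ℝ} (hL : 1 ≤ L)
    (hF : ∀ n, GF (F n) B) (hG : Integrable G) (hFG : ∀ n x, |F n x| ≤ G x)
    (hlim : ∀ x, Tendsto (fun n => F n x) atTop (nhds (F' x))) (x : Eu d) :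
    Tendsto (fun n => RR L (F n) x) atTop (nhds (RR L F' x)) := by
  refine tendsto_integral_of_dominated_convergence
    (fun t => B * (Real.exp (-t) * t ^ ((1:ℝ) - 1)))
    (fun n => tm_meas (cv_smeas_t (hF n).meas HK_sm x)) (wt_integrable one_pos B) (fun n => ?_) ?_
  · filter_upwards [ae_restrict_mem measurableSet_Ioi] with t ht
    exact wt_bound hL ht (h0_bound (hF n) ht x)
  · filter_upwards [ae_restrict_mem measurableSet_Ioi] with t ht
    refine Tendsto.const_smul ?_ _
    have ht' : 0 < t := ht
    refine tendsto_integral_of_dominated_convergence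
      (fun y => G y * (4 * Real.pi * t) ^ (-(d : ℝ) / 2))
      (fun n => cv_meas (hF n).int HK_continuous x) (hG.mul_const _) (fun n => ?_) ?_
    · refine Eventually.of_forall fun y => ?_
      rw [norm_smul]
      exact mul_le_mul (hFG n y) (HK_norm_bd ht' _) (norm_nonneg _)
        ((abs_nonneg _).trans (hFG n y))
    · exact Eventually.of_forall fun y => (hlim y).smul_const _

end resolvent


section resolvent2
variable {d : ℕ}

theorem HK_bound_holder {t α : ℝ} (ht : 0 < t) (hα : 0 ≤ α) (hα1 : α ≤ 1) (x : Eu d) :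
    ‖x‖ ^ α * ‖HK t x‖ ≤ CK d * t ^ (α/2) * HK (2*t) x := by
  have hm := HK_master ht x
  have hp := HK_pos ht x
  have hp2 := HK_pos (d := d) (show 0 < 2*t by positivity) x
  have hs : 0 < √t := by positivity
  have h1 : ‖x‖^α ≤ (1 + ‖x‖/√t) * t^(α/2) := by
    have e : ‖x‖ = (‖x‖/√t) * √t := by field_simp
    have e1 : ‖x‖^α = (‖x‖/√t)^α * t^(α/2) := by
      conv_lhs => rw [e, Real.mul_rpow (by positivity) hs.le]
      rw [Real.sqrt_eq_rpow, ← Real.rpow_mul ht.le]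
      congr 2; ring
    rw [e1]
    gcongr
    have a : 0 ≤ ‖x‖/√t := by positivity
    calc (‖x‖/√t)^α ≤ (1 + ‖x‖/√t)^α := by gcongr; linarith
      _ ≤ (1 + ‖x‖/√t)^(1:ℝ) := Real.rpow_le_rpow_of_exponent_le (by linarith) hα1
      _ = _ := by simp
  have h4 : 100 * 2 ^ ((d:ℝ)/2) ≤ CK d := by
    unfold CK
    have : (0:ℝ) ≤ d := Nat.cast_nonneg d
    have h5 : (0:ℝ) < 2 ^ ((d:ℝ)/2) := by positivity
    nlinarith
  have h6 : 1 ≤ 2 + ‖x‖^2 / t := by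
    have : 0 ≤ ‖x‖^2 / t := by positivity
    linarith
  rw [Real.norm_of_nonneg hp.le]
  calc ‖x‖ ^ α * HK t x ≤ ((1 + ‖x‖/√t) * t^(α/2)) * HK t x := by gcongr
    _ = t^(α/2) * ((1 + ‖x‖/√t) * 1 * HK t x) := by ring
    _ ≤ t^(α/2) * ((1 + ‖x‖/√t) * (2 + ‖x‖^2 / t) * HK t x) := by gcongr
    _ ≤ t^(α/2) * (CK d * HK (2*t) x) := by
        refine mul_le_mul_of_nonneg_left (hm.trans ?_) (by positivity)
        gcongr
    _ = _ := by ring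

theorem cv_HK_deriv {F : Eu d → ℝ} {B t : ℝ} (hF : GF F B) (ht : 0 < t) (x : Eu d) :
    HasDerivAt (fun t => cv (HK t) F x) (cv (HKt t) F x) t := by
  set Q := CK d * (t/2)⁻¹ * (4 * Real.pi * (2*(t/2))) ^ (-(d : ℝ) / 2)
  have hs : Set.Ioi (t/2) ∈ nhds t := Ioi_mem_nhds (by linarith)
  refine (hasDerivAt_integral_of_dominated_loc_of_deriv_le (s := Set.Ioi (t/2))
    (F := fun t y => F y • HK t (x - y)) (F' := fun t y => F y • HKt t (x - y)) (bound := fun y => ‖F y‖ * Q) hs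
    (Eventually.of_forall fun t => cv_meas hF.int HK_continuous x)
    (cv_integrable hF.int HK_continuous (HK_norm_bd ht) x)
    (cv_meas hF.int HKt_continuous x) (Eventually.of_forall fun y s hs => ?_)
    (hF.int.norm.mul_const Q) (Eventually.of_forall fun y s hs => ?_)).2
  · have hs' : t/2 < s := hs
    have hs0 : 0 < s := by linarith
    rw [norm_smul]
    refine mul_le_mul_of_nonneg_left ((HKt_norm_bd hs0 _).trans ?_) (norm_nonneg _)
    have := CK_pos d
    have h1 : (4 * Real.pi * (2*s)) ^ (-(d : ℝ) / 2) ≤ (4 * Real.pi * (2*(t/2))) ^ (-(d : ℝ) / 2) := by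
      refine Real.rpow_le_rpow_of_nonpos (by positivity) (by gcongr) ?_
      have : (0:ℝ) ≤ d := Nat.cast_nonneg d
      linarith
    have h2 : s⁻¹ ≤ (t/2)⁻¹ := by gcongr
    show _ ≤ CK d * (t/2)⁻¹ * (4 * Real.pi * (2*(t/2))) ^ (-(d : ℝ) / 2)
    gcongr
  · have hs' : t/2 < s := hs
    have h0 : 0 < s := by linarith
    have h := HK_hasDerivAt h0 (x - y)
    exact h.const_mul (F y)

theorem cv_trace {F : Eu d → ℝ} {B t : ℝ} (hF : GF F B) (ht : 0 < t) (x : Eu d) :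
    ∑ i, cv (HK2 t) F x (ee i) (ee i) = cv (HKt t) F x := by
  have hi := cv_integrable hF.int HK2_continuous (HK2_norm_bd ht) x
  have : ∀ i : Fin d, cv (HK2 t) F x (ee i) (ee i) = ∫ y, F y * HK2 t (x - y) (ee i) (ee i) := by
    intro i
    unfold cv
    rw [ContinuousLinearMap.integral_apply hi, ContinuousLinearMap.integral_apply
      (hi.apply_continuousLinearMap _)]
    rfl
  simp_rw [this]
  rw [← integral_finsetSum]
  · unfold cv
    refine integral_congr_ae (Eventually.of_forall fun y => ?_)
    simp only
    rw [← Finset.mul_sum, HK2_trace, smul_eq_mul]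
  · intro i _
    exact (hi.apply_continuousLinearMap (ee i)).apply_continuousLinearMap (ee i)

theorem cv_HK_zero {F : Eu d → ℝ} {B A α : ℝ} (hF : GF F B)
    (hα : 0 < α) (hα1 : α ≤ 1) (hA0 : 0 ≤ A) (hA : ∀ x y, |F y - F x| ≤ A * ‖y - x‖ ^ α)
    (x : Eu d) : Tendsto (fun t => cv (HK t) F x) (nhdsWithin 0 (Set.Ioi 0)) (nhds (F x)) := by
  have hb : ∀ t, 0 < t → ‖cv (HK t) F x - F x‖ ≤ A * (CK d * t ^ (α/2)) := by
    intro t ht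
    have := cv_holder (s := 2*t) (by positivity) hF (K := HK t) HK_continuous (HK_integrable ht)
      (HK_norm_bd ht) (fun w => HK_bound_holder ht hα.le hα1 w) hA0 hA x
    rwa [HK_integral ht, smul_eq_mul, mul_one] at this
  rw [tendsto_iff_norm_sub_tendsto_zero]
  have h0 : Tendsto (fun t : ℝ => A * (CK d * t ^ (α/2))) (nhdsWithin 0 (Set.Ioi 0)) (nhds 0) := by
    have hc : Continuous fun t : ℝ => A * (CK d * t ^ (α/2)) := by
      have : Continuous fun t : ℝ => t ^ (α/2) := Real.continuous_rpow_const (by positivity)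
      fun_prop
    have := hc.tendsto 0
    rw [Real.zero_rpow (by positivity)] at this
    simp only [mul_zero] at this
    exact this.mono_left nhdsWithin_le_nhds
  refine squeeze_zero' (Eventually.of_forall fun _ => norm_nonneg _) ?_ h0
  filter_upwards [self_mem_nhdsWithin] with t ht
  exact hb t ht

theorem RR_laplacian {F : Eu d → ℝ} {B L A α : ℝ} (hL : 1 ≤ L) (hF : GF F B)
    (hα : 0 < α) (hα1 : α ≤ 1) (hA0 : 0 ≤ A) (hA : ∀ x y, |F y - F x| ≤ A * ‖y - x‖ ^ α)
    (x : Eu d) : laplacian (RR L F) x = L * RR L F x - F x := by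
  have e1 : fderiv ℝ (RR L F) = RR1 L F := funext fun x => (RR_hasFDerivAt hL hF x).fderiv
  have e2 : fderiv ℝ (RR1 L F) x = RR2 L F x := (RR1_hasFDerivAt hL hF hα hα1 hA0 hA x).fderiv
  have hi2 : IntegrableOn (fun t => Real.exp (-(L * t)) • cv (HK2 t) F x) (Set.Ioi 0) :=
    tm_integrable hL (half_pos hα) (cv_smeas_t hF.meas HK2_measurable x)
      (fun t ht => h2_bound hF ht hα.le hα1 hA0 hA x)
  have e3 : laplacian (RR L F) x
      = ∫ t in Set.Ioi 0, Real.exp (-(L * t)) * cv (HKt t) F x := by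
    unfold laplacian
    rw [e1, e2]
    have : ∀ i : Fin d, RR2 L F x (ee i) (ee i)
        = ∫ t in Set.Ioi 0, Real.exp (-(L * t)) * cv (HK2 t) F x (ee i) (ee i) := by
      intro i
      unfold RR2 TI
      rw [ContinuousLinearMap.integral_apply hi2, ContinuousLinearMap.integral_apply
        (hi2.apply_continuousLinearMap _)]
      rfl
    refine (Finset.sum_congr rfl fun i _ => this i).trans ?_
    rw [← integral_finsetSum]
    · refine setIntegral_congr_fun measurableSet_Ioi fun t ht => ?_
      rw [← Finset.mul_sum, cv_trace hF ht]
    · intro i _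
      exact (hi2.apply_continuousLinearMap (ee i)).apply_continuousLinearMap (ee i)
  have hit : IntegrableOn (fun t => Real.exp (-(L * t)) * cv (HKt t) F x) (Set.Ioi 0) := by
    have : IntegrableOn (fun t => ∑ i : Fin d, Real.exp (-(L * t)) * cv (HK2 t) F x (ee i) (ee i))
        (Set.Ioi 0) := by
      refine integrable_finsetSum _ fun i _ => ?_
      exact (hi2.apply_continuousLinearMap (ee i)).apply_continuousLinearMap (ee i)
    refine this.congr_fun (fun t ht => ?_) measurableSet_Ioi
    simp only
    rw [← Finset.mul_sum, cv_trace hF ht]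
  have hi0 := RR_integrableOn hL hF x
  have hi00 : IntegrableOn (fun t => L * (Real.exp (-(L * t)) * cv (HK t) F x)) (Set.Ioi 0) :=
    hi0.const_mul L
  classical
  let f : ℝ → ℝ := fun t => if t ≤ 0 then F x else Real.exp (-(L * t)) * cv (HK t) F x
  have hf : ∀ t, 0 < t → f t = Real.exp (-(L * t)) * cv (HK t) F x := fun t ht => by
    simp [f, ht]
  have hfd : ∀ t ∈ Set.Ioi (0:ℝ), HasDerivAt f (Real.exp (-(L * t)) * cv (HKt t) F x
      - L * (Real.exp (-(L * t)) * cv (HK t) F x)) t := by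
    intro t ht
    have h1 : HasDerivAt (fun t => Real.exp (-(L*t))) (Real.exp (-(L*t)) * (-(L * 1))) t :=
      (((hasDerivAt_id t).const_mul L).neg).exp
    have h2 := h1.mul (cv_HK_deriv hF ht x)
    refine (h2.congr_of_eventuallyEq ?_).congr_deriv (by ring)
    filter_upwards [Ioi_mem_nhds ht] with s hs
    exact hf s hs
  have hf0 : f 0 = F x := by simp [f]
  have hcont : ContinuousWithinAt f (Set.Ici 0) 0 := by
    rw [← continuousWithinAt_Ioi_iff_Ici]
    unfold ContinuousWithinAt
    rw [hf0]
    have h1 : Tendsto (fun t => Real.exp (-(L*t))) (nhdsWithin 0 (Set.Ioi 0)) (nhds 1) := by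
      have hc : Continuous fun t => Real.exp (-(L*t)) := by fun_prop
      have := (hc.tendsto 0).mono_left (nhdsWithin_le_nhds (s := Set.Ioi 0))
      simpa using this
    have h2 := h1.mul (cv_HK_zero hF hα hα1 hA0 hA x)
    rw [one_mul] at h2
    refine h2.congr' ?_
    filter_upwards [self_mem_nhdsWithin] with s hs
    exact (hf s hs).symm
  have hinf : Tendsto f atTop (nhds 0) := by
    have h1 : Tendsto (fun t : ℝ => Real.exp (-t) * B) atTop (nhds 0) := by
      simpa using (Real.tendsto_exp_neg_atTop_nhds_zero).mul_const B
    refine squeeze_zero_norm' ?_ h1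
    filter_upwards [eventually_gt_atTop 0] with t ht
    rw [hf t ht, norm_mul, Real.norm_of_nonneg (Real.exp_pos _).le]
    have hb := h0_bound hF ht x
    rw [sub_self, Real.rpow_zero, mul_one] at hb
    have he : Real.exp (-(L*t)) ≤ Real.exp (-t) := by
      apply Real.exp_le_exp.2; nlinarith
    gcongr
  have hftc := integral_Ioi_of_hasDerivAt_of_tendsto hcont hfd (hit.sub hi00) hinf
  rw [integral_sub hit hi00, integral_const_mul, hf0, ← e3] at hftc
  have : RR L F x = ∫ t in Set.Ioi 0, Real.exp (-(L * t)) * cv (HK t) F x := rfl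
  rw [← this] at hftc
  linarith

theorem RR_integrable {F : Eu d → ℝ} {B L : ℝ} (hL : 1 ≤ L) (hF : GF F B) :
    Integrable (RR L F) := by
  have hsm : AEStronglyMeasurable (fun q : ℝ × Eu d => Real.exp (-(L * q.1)) * cv (HK q.1) F q.2)
      ((volume.restrict (Set.Ioi 0)).prod volume) := by
    have hc : Continuous fun q : ℝ × Eu d => Real.exp (-(L * q.1)) := by fun_prop
    exact (hc.stronglyMeasurable.mul (cv_smeas hF.meas HK_sm)).aestronglyMeasurable
  have hci : ∀ t, 0 < t → Integrable (cv (HK t) F) := fun t ht =>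
    hF.int.integrable_convolution (ContinuousLinearMap.lsmul ℝ ℝ) (HK_integrable ht)
  have hcb : ∀ t, 0 < t → ∫ x, ‖cv (HK t) F x‖ ≤ ∫ y, |F y| := by
    intro t ht
    have hi := hF.int.norm.integrable_convolution (ContinuousLinearMap.lsmul ℝ ℝ)
      (HK_integrable (d := d) ht)
    have := integral_convolution (μ := volume) (ν := volume) (ContinuousLinearMap.lsmul ℝ ℝ) hF.int.norm
      (HK_integrable (d := d) ht)
    rw [HK_integral ht] at this
    simp only [ContinuousLinearMap.lsmul_apply, smul_eq_mul, mul_one] at this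
    refine (integral_mono (hci t ht).norm hi fun x => ?_).trans this.le
    refine (norm_integral_le_integral_norm _).trans (le_of_eq ?_)
    refine integral_congr_ae (Eventually.of_forall fun y => ?_)
    simp [abs_of_pos (HK_pos ht _)]
  have hprod : Integrable (fun q : ℝ × Eu d => Real.exp (-(L * q.1)) * cv (HK q.1) F q.2)
      ((volume.restrict (Set.Ioi 0)).prod volume) := by
    rw [integrable_prod_iff hsm]
    constructor
    · filter_upwards [ae_restrict_mem measurableSet_Ioi] with t ht
      exact (hci t ht).const_mul _
    · refine (wt_integrable one_pos (∫ y, |F y|)).mono' hsm.norm.integral_prod_right' ?_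
      filter_upwards [ae_restrict_mem measurableSet_Ioi] with t ht
      have ht' : 0 < t := ht
      simp only [norm_mul]
      rw [integral_const_mul, ← smul_eq_mul (a := ‖Real.exp (-(L*t))‖),
        Real.norm_of_nonneg (Real.exp_pos _).le]
      refine wt_bound (s := 1) hL ht' ?_
      rw [Real.norm_of_nonneg (integral_nonneg fun _ => norm_nonneg _), sub_self, Real.rpow_zero,
        mul_one]
      exact hcb t ht'
  exact hprod.integral_prod_right

end resolvent2


section core
variable {d : ℕ}

/-- data for the iteration -/
structure Dat (L : ℝ) (f p : Eu d → ℝ) (Bf P α Af Ap : ℝ) : Prop where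
  hL : 1 ≤ L
  fc : Continuous f
  pc : Continuous p
  fs : HasCompactSupport f
  ps : HasCompactSupport p
  f0 : ∀ x, 0 ≤ f x
  p0 : ∀ x, 0 ≤ p x
  fB : ∀ x, f x ≤ Bf
  pP : ∀ x, p x ≤ P
  a0 : 0 < α
  a1 : α ≤ 1
  Af0 : 0 ≤ Af
  Ap0 : 0 ≤ Ap
  fH : ∀ x y, |f y - f x| ≤ Af * ‖y - x‖ ^ α
  pH : ∀ x y, |p y - p x| ≤ Ap * ‖y - x‖ ^ α
  form : ∀ φ : Eu d → ℝ, ContDiff ℝ 1 φ → HasCompactSupport φ →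
    ∫ x, (φ x)^2 ≤ ∫ x, (gsq φ x + (L - p x) * (φ x)^2)

/-- source term -/
def Fp (f p s : Eu d → ℝ) : Eu d → ℝ := fun x => f x + p x * s x

variable {L : ℝ} {f p : Eu d → ℝ} {Bf P α Af Ap : ℝ}

theorem Dat.P0 (D : Dat L f p Bf P α Af Ap) : 0 ≤ P := (D.p0 0).trans (D.pP 0)
theorem Dat.Bf0 (D : Dat L f p Bf P α Af Ap) : 0 ≤ Bf := (D.f0 0).trans (D.fB 0)

theorem Dat.fi (D : Dat L f p Bf P α Af Ap) : Integrable f :=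
  D.fc.integrable_of_hasCompactSupport D.fs
theorem Dat.pi (D : Dat L f p Bf P α Af Ap) : Integrable p :=
  D.pc.integrable_of_hasCompactSupport D.ps

theorem Dat.psi (D : Dat L f p Bf P α Af Ap) {s : Eu d → ℝ} {B : ℝ} (hs : Measurable s)
    (hB : ∀ x, |s x| ≤ B) : Integrable fun x => p x * s x := by
  refine (D.pi.mul_const B).mono' (D.pc.measurable.mul hs).aestronglyMeasurable
    (Eventually.of_forall fun x => ?_)
  rw [Real.norm_eq_abs, abs_mul, abs_of_nonneg (D.p0 x)]
  exact mul_le_mul_of_nonneg_left (hB x) (D.p0 x)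

theorem Fp_GF (D : Dat L f p Bf P α Af Ap) {s : Eu d → ℝ} {B : ℝ} (hs : Measurable s)
    (hB : ∀ x, |s x| ≤ B) : GF (Fp f p s) (Bf + P * B) where
  meas := D.fc.measurable.add (D.pc.measurable.mul hs)
  int := D.fi.add (D.psi hs hB)
  bd := fun x => by
    have hP := D.P0
    refine (abs_add_le _ _).trans ?_
    rw [abs_of_nonneg (D.f0 x), abs_mul, abs_of_nonneg (D.p0 x)]
    exact add_le_add (D.fB x) (mul_le_mul (D.pP x) (hB x) (abs_nonneg _) hP)

theorem lip_holder {s : Eu d → ℝ} {B Λ : ℝ} (hΛ : 0 ≤ Λ) (hB : ∀ x, |s x| ≤ B) (a0 : 0 < α)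
    (a1 : α ≤ 1) (hl : ∀ x y, |s y - s x| ≤ Λ * ‖y - x‖) (x y : Eu d) :
    |s y - s x| ≤ (Λ + 2 * B) * ‖y - x‖ ^ α := by
  have hB0 : 0 ≤ B := (abs_nonneg _).trans (hB 0)
  have hn := norm_nonneg (y - x)
  rcases le_total ‖y - x‖ 1 with h | h
  · have h1 : ‖y - x‖ ≤ ‖y - x‖ ^ α := by
      rcases hn.eq_or_lt with h0 | h0
      · rw [← h0, Real.zero_rpow a0.ne']
      · simpa using Real.rpow_le_rpow_of_exponent_ge h0 h a1
    have h2 : 0 ≤ ‖y - x‖ ^ α := by positivity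
    calc _ ≤ Λ * ‖y - x‖ := hl x y
      _ ≤ Λ * ‖y - x‖ ^ α := by gcongr
      _ ≤ _ := by nlinarith
  · have h1 : 1 ≤ ‖y - x‖ ^ α := Real.one_le_rpow h a0.le
    have h2 : |s y - s x| ≤ 2 * B := by
      refine (abs_sub _ _).trans ?_
      linarith [hB x, hB y]
    nlinarith

theorem Fp_holder (D : Dat L f p Bf P α Af Ap) {s : Eu d → ℝ} {B Λ : ℝ}
    (hB : ∀ x, |s x| ≤ B) (hΛ : 0 ≤ Λ) (hl : ∀ x y, |s y - s x| ≤ Λ * ‖y - x‖) (x y : Eu d) :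
    |Fp f p s y - Fp f p s x| ≤ (Af + Ap * B + P * (Λ + 2 * B)) * ‖y - x‖ ^ α := by
  have hB0 : 0 ≤ B := (abs_nonneg _).trans (hB 0)
  have h2 : 0 ≤ ‖y - x‖ ^ α := by positivity
  have e : Fp f p s y - Fp f p s x = (f y - f x) + ((p y - p x) * s y + p x * (s y - s x)) := by
    unfold Fp; ring
  rw [e]
  refine (abs_add_le _ _).trans ?_
  have h3 := abs_add_le ((p y - p x) * s y) (p x * (s y - s x))
  have h4 : |(p y - p x) * s y| ≤ Ap * ‖y - x‖ ^ α * B := by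
    rw [abs_mul]
    exact mul_le_mul (D.pH x y) (hB y) (abs_nonneg _) (mul_nonneg D.Ap0 h2)
  have h5 : |p x * (s y - s x)| ≤ P * ((Λ + 2 * B) * ‖y - x‖ ^ α) := by
    rw [abs_mul, abs_of_nonneg (D.p0 x)]
    exact mul_le_mul (D.pP x) (lip_holder hΛ hB D.a0 D.a1 hl x y) (abs_nonneg _) D.P0
  have := D.fH x y
  linarith

theorem Fp_A0 (D : Dat L f p Bf P α Af Ap) {B Λ : ℝ} (hB : 0 ≤ B) (hΛ : 0 ≤ Λ) :
    0 ≤ Af + Ap * B + P * (Λ + 2 * B) := by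
  have := D.Af0
  have := D.Ap0
  have := D.P0
  positivity

/-- one step of regularity -/
theorem step (D : Dat L f p Bf P α Af Ap) {s : Eu d → ℝ} {B Λ : ℝ} (hs : Continuous s)
    (hB : ∀ x, |s x| ≤ B) (hΛ : 0 ≤ Λ) (hl : ∀ x y, |s y - s x| ≤ Λ * ‖y - x‖) :
    ContDiff ℝ 2 (RR L (Fp f p s)) ∧
      ∀ x, laplacian (RR L (Fp f p s)) x = L * RR L (Fp f p s) x - Fp f p s x := by
  have hB0 : 0 ≤ B := (abs_nonneg _).trans (hB 0)
  exact ⟨RR_C2 D.hL (Fp_GF D hs.measurable hB) D.a0 D.a1 (Fp_A0 D hB0 hΛ)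
    (Fp_holder D hB hΛ hl), RR_laplacian D.hL (Fp_GF D hs.measurable hB) D.a0 D.a1
    (Fp_A0 D hB0 hΛ) (Fp_holder D hB hΛ hl)⟩

/-- iteration -/
noncomputable def SS (L : ℝ) (f p : Eu d → ℝ) : ℕ → Eu d → ℝ
  | 0 => fun _ => 0
  | n + 1 => RR L (Fp f p (SS L f p n))

theorem SS_basic (D : Dat L f p Bf P α Af Ap) (n : ℕ) :
    Continuous (SS L f p n) ∧ (∃ B, ∀ x, |SS L f p n x| ≤ B) ∧
    (∃ Λ, 0 ≤ Λ ∧ ∀ x y, |SS L f p n y - SS L f p n x| ≤ Λ * ‖y - x‖) := by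
  induction n with
  | zero => exact ⟨continuous_const, ⟨0, by simp [SS]⟩, ⟨0, le_rfl, by simp [SS]⟩⟩
  | succ n ih =>
    obtain ⟨hc, ⟨B, hB⟩, _⟩ := ih
    have hG := Fp_GF D hc.measurable hB
    refine ⟨RR_continuous D.hL hG, ⟨_, RR_abs D.hL hG⟩, ⟨_, ?_, RR_lip D.hL hG⟩⟩
    have := CK_pos d
    have := hG.B_nonneg
    have := Real.Gamma_pos_of_pos one_half_pos
    positivity

theorem SS_nonneg (D : Dat L f p Bf P α Af Ap) (n : ℕ) (x : Eu d) : 0 ≤ SS L f p n x := by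
  induction n generalizing x with
  | zero => simp [SS]
  | succ n ih =>
    exact RR_nonneg (fun y => add_nonneg (D.f0 y) (mul_nonneg (D.p0 y) (ih y))) x

theorem SS_mono (D : Dat L f p Bf P α Af Ap) (n : ℕ) (x : Eu d) :
    SS L f p n x ≤ SS L f p (n+1) x := by
  induction n generalizing x with
  | zero => exact SS_nonneg D 1 x
  | succ n ih =>
    obtain ⟨hc, ⟨B, hB⟩, _⟩ := SS_basic D n
    obtain ⟨hc', ⟨B', hB'⟩, _⟩ := SS_basic D (n+1)
    exact RR_mono D.hL (Fp_GF D hc.measurable hB) (Fp_GF D hc'.measurable hB')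
      (fun y => add_le_add le_rfl (mul_le_mul_of_nonneg_left (ih y) (D.p0 y))) x

theorem SS_C2 (D : Dat L f p Bf P α Af Ap) (n : ℕ) :
    ContDiff ℝ 2 (SS L f p (n+1)) ∧ ∀ x, laplacian (SS L f p (n+1)) x =
      L * SS L f p (n+1) x - (f x + p x * SS L f p n x) := by
  obtain ⟨hc, ⟨B, hB⟩, ⟨Λ, hΛ, hl⟩⟩ := SS_basic D n
  exact step D hc hB hΛ hl

theorem SS_integrable (D : Dat L f p Bf P α Af Ap) (n : ℕ) : Integrable (SS L f p n) := by
  cases n with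
  | zero => exact integrable_zero _ _ _
  | succ n =>
    obtain ⟨hc, ⟨B, hB⟩, _⟩ := SS_basic D n
    exact RR_integrable D.hL (Fp_GF D hc.measurable hB)

theorem SS_sq_integrable (D : Dat L f p Bf P α Af Ap) (n : ℕ) :
    Integrable fun x => (SS L f p n x)^2 := by
  obtain ⟨hc, ⟨B, hB⟩, _⟩ := SS_basic D n
  refine ((SS_integrable D n).norm.mul_const B).mono' (hc.pow 2).aestronglyMeasurable
    (Eventually.of_forall fun x => ?_)
  rw [norm_pow, sq]
  exact mul_le_mul_of_nonneg_left (hB x) (norm_nonneg _)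

theorem cutoff (d : ℕ) : ∃ C : ℝ, 0 ≤ C ∧ ∃ ζ : ℕ → Eu d → ℝ, (∀ k, ContDiff ℝ 1 (ζ k)) ∧
    (∀ k, HasCompactSupport (ζ k)) ∧ (∀ k x, 0 ≤ ζ k x ∧ ζ k x ≤ 1) ∧
    (∀ k x, gsq (ζ k) x ≤ C * ((k:ℝ)+1)⁻¹^2) ∧
    ∀ x, Tendsto (fun k => ζ k x) atTop (nhds 1) := by
  let χ : ContDiffBump (0 : Eu d) := ⟨1, 2, by norm_num, by norm_num⟩
  have hχ : ContDiff ℝ 1 χ := χ.contDiff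
  obtain ⟨C, hC⟩ := (gsq_compact χ.hasCompactSupport).exists_bound_of_continuous
    (continuous_gsq hχ)
  refine ⟨C, (norm_nonneg _).trans (hC 0), fun k x => χ (((k:ℝ)+1)⁻¹ • x), fun k => ?_, fun k => ?_,
    fun k x => ⟨χ.nonneg, χ.le_one⟩, fun k x => ?_, fun x => ?_⟩
  · exact hχ.comp (contDiff_const_smul _)
  · exact χ.hasCompactSupport.comp_smul (by positivity)
  · have h1 : HasFDerivAt (fun x => χ (((k:ℝ)+1)⁻¹ • x))
        ((fderiv ℝ χ (((k:ℝ)+1)⁻¹ • x)).comp (((k:ℝ)+1)⁻¹ • ContinuousLinearMap.id ℝ (Eu d))) x :=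
      ((hχ.differentiable one_ne_zero _).hasFDerivAt).comp x
        (f := fun x => ((k:ℝ)+1)⁻¹ • x)
        (((k:ℝ)+1)⁻¹ • ContinuousLinearMap.id ℝ (Eu d)).hasFDerivAt
    have h2 : gsq (fun x => χ (((k:ℝ)+1)⁻¹ • x)) x = gsq χ (((k:ℝ)+1)⁻¹ • x) * ((k:ℝ)+1)⁻¹^2 := by
      unfold gsq
      rw [h1.fderiv, Finset.sum_mul]
      refine Finset.sum_congr rfl fun i _ => ?_
      generalize ((k:ℝ)+1)⁻¹ = c
      simp
      ring
    rw [h2]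
    gcongr
    exact (le_abs_self _).trans (hC _)
  · refine tendsto_const_nhds.congr' ?_
    obtain ⟨N, hN⟩ := exists_nat_gt ‖x‖
    filter_upwards [eventually_ge_atTop N] with k hk
    symm
    refine χ.one_of_mem_closedBall ?_
    rw [mem_closedBall_zero_iff, norm_smul, norm_inv, Real.norm_of_nonneg (by positivity)]
    have : (N:ℝ) ≤ k := by exact_mod_cast hk
    rw [inv_mul_le_iff₀ (by positivity)]
    show ‖x‖ ≤ ((k:ℝ)+1) * 1
    linarith

theorem SS_energy (D : Dat L f p Bf P α Af Ap) (n : ℕ) :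
    ∫ x, (SS L f p (n+1) x)^2 ≤ ∫ x, (f x)^2 := by
  obtain ⟨hC2, hlap⟩ := SS_C2 D n
  obtain ⟨hc0, _, _⟩ := SS_basic D n
  set s := SS L f p (n+1) with hs
  have hs2 : Integrable fun x => (s x)^2 := SS_sq_integrable D (n+1)
  have hsc : Continuous s := hC2.continuous
  have hs0 : ∀ x, 0 ≤ s x := SS_nonneg D (n+1)
  have hle : ∀ x, SS L f p n x ≤ s x := SS_mono D n
  have hsf : Integrable fun x => s x * f x :=
    (hsc.mul D.fc).integrable_of_hasCompactSupport D.fs.mul_left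
  obtain ⟨C, hC, ζ, z1, zc, z01, zg, zl⟩ := cutoff d
  have key : ∀ k, ∫ x, (ζ k x * s x)^2 ≤ (∫ x, s x * f x)
      + C * ((k:ℝ)+1)⁻¹^2 * ∫ x, (s x)^2 := by
    intro k
    have zcont := (z1 k).continuous
    have sup : ∀ g : Eu d → ℝ, HasCompactSupport fun x => (ζ k x)^2 * g x := by
      intro g
      refine (zc k).mono fun x hx hz => ?_
      simp [hz] at hx
    have hfc := D.fc
    have i1 : Integrable fun x => (ζ k x)^2 * s x * f x := by
      refine Continuous.integrable_of_hasCompactSupport (by fun_prop) ?_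
      simpa [mul_assoc] using sup fun x => s x * f x
    have hpc := D.pc
    have i2 : Integrable fun x => (L - p x) * (ζ k x * s x)^2 := by
      refine Continuous.integrable_of_hasCompactSupport (by fun_prop) ?_
      have e : (fun x => (L - p x) * (ζ k x * s x)^2)
          = fun x => (ζ k x)^2 * ((L - p x) * (s x)^2) := by
        funext x; ring
      rw [e]
      exact sup _
    have hzs1 : ContDiff ℝ 1 fun x => ζ k x * s x := (z1 k).mul (hC2.of_le (by norm_num))
    have hzsc : HasCompactSupport fun x => ζ k x * s x := (zc k).mul_right
    have i3 : Integrable fun x => gsq (fun x => ζ k x * s x) x :=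
      (continuous_gsq hzs1).integrable_of_hasCompactSupport (gsq_compact hzsc)
    have i4 : Integrable fun x => gsq (ζ k) x * (s x)^2 :=
      ((continuous_gsq (z1 k)).mul (hsc.pow 2)).integrable_of_hasCompactSupport
        (gsq_compact (zc k)).mul_right
    have i5 : Integrable fun x => (ζ k x)^2 * s x * (-laplacian s x) := by
      refine Continuous.integrable_of_hasCompactSupport ?_ ?_
      · have := continuous_laplacian hC2
        fun_prop
      · simpa [mul_assoc] using sup fun x => s x * (-laplacian s x)
    have hE := energy (z1 k) (zc k) hC2
    have hF := D.form _ hzs1 hzsc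
    rw [integral_add i3 i2] at hF
    have h1 : ∫ x, (ζ k x)^2 * s x * (-laplacian s x) ≤
        ∫ x, ((ζ k x)^2 * s x * f x - (L - p x) * (ζ k x * s x)^2) := by
      refine integral_mono i5 (i1.sub i2) fun x => ?_
      simp only
      rw [hlap x]
      have : 0 ≤ (ζ k x)^2 * s x * p x * (s x - SS L f p n x) :=
        mul_nonneg (mul_nonneg (mul_nonneg (sq_nonneg _) (hs0 x)) (D.p0 x))
          (sub_nonneg.2 (hle x))
      nlinarith
    rw [integral_sub i1 i2] at h1
    have h2 : ∫ x, (ζ k x)^2 * s x * f x ≤ ∫ x, s x * f x := by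
      refine integral_mono i1 hsf fun x => ?_
      simp only
      have a := z01 k x
      have b := mul_nonneg (hs0 x) (D.f0 x)
      have c : (ζ k x)^2 ≤ 1 := by nlinarith
      nlinarith
    have h3 : ∫ x, gsq (ζ k) x * (s x)^2 ≤ C * ((k:ℝ)+1)⁻¹^2 * ∫ x, (s x)^2 := by
      rw [← integral_const_mul]
      refine integral_mono i4 (hs2.const_mul _) fun x => ?_
      exact mul_le_mul_of_nonneg_right (zg k x) (sq_nonneg _)
    linarith
  have lim1 : Tendsto (fun k => ∫ x, (ζ k x * s x)^2) atTop (nhds (∫ x, (s x)^2)) := by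
    refine tendsto_integral_of_dominated_convergence (fun x => (s x)^2) (fun k => ?_) hs2
      (fun k => Eventually.of_forall fun x => ?_) (Eventually.of_forall fun x => ?_)
    · exact (((z1 k).continuous.mul hsc).pow 2).aestronglyMeasurable
    · rw [Real.norm_of_nonneg (sq_nonneg _), mul_pow]
      have a := z01 k x
      have c : (ζ k x)^2 ≤ 1 := by nlinarith
      nlinarith [sq_nonneg (s x)]
    · have := ((zl x).mul_const (s x)).pow 2
      simpa using this
  have lim2 : Tendsto (fun k : ℕ => (∫ x, s x * f x) + C * ((k:ℝ)+1)⁻¹^2 * ∫ x, (s x)^2) atTop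
      (nhds ((∫ x, s x * f x) + C * 0^2 * ∫ x, (s x)^2)) := by
    have h : Tendsto (fun k : ℕ => ((k:ℝ)+1)⁻¹) atTop (nhds 0) := by
      simpa using tendsto_one_div_add_atTop_nhds_zero_nat (𝕜 := ℝ)
    exact (((h.pow 2).const_mul C).mul_const _).const_add _
  have h5 := le_of_tendsto_of_tendsto' lim1 lim2 key
  have hf2 : Integrable fun x => (f x)^2 :=
    (D.fc.pow 2).integrable_of_hasCompactSupport (by
      simpa [sq] using D.fs.mul_left (f := f))
  have h6 : ∫ x, s x * f x ≤ ∫ x, ((1/2) * (s x)^2 + (1/2) * (f x)^2) := by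
    refine integral_mono hsf ((hs2.const_mul _).add (hf2.const_mul _)) fun x => ?_
    simp only
    nlinarith [sq_nonneg (s x - f x)]
  rw [integral_add (hs2.const_mul _) (hf2.const_mul _), integral_const_mul,
    integral_const_mul] at h6
  linarith

end core


section limit
variable {d : ℕ} {L : ℝ} {f p : Eu d → ℝ} {Bf P α Af Ap : ℝ}

theorem SS_bdd (D : Dat L f p Bf P α Af Ap) : ∃ M, ∀ n x, |SS L f p n x| ≤ M := by
  have hP := D.P0
  have hBf := D.Bf0
  have hf2 : Integrable fun x => (f x)^2 :=
    (D.fc.pow 2).integrable_of_hasCompactSupport (by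
      simpa [sq] using D.fs.mul_left (f := f))
  have hp2 : Integrable fun x => (p x)^2 :=
    (D.pc.pow 2).integrable_of_hasCompactSupport (by
      simpa [sq] using D.ps.mul_left (f := p))
  set J := (∫ x, f x) + ((1/2) * (∫ x, (p x)^2) + (1/2) * ∫ x, (f x)^2) with hJ
  have hJ0 : 0 ≤ J := by
    have h1 : 0 ≤ ∫ x, f x := integral_nonneg D.f0
    have h2 : 0 ≤ ∫ x, (p x)^2 := integral_nonneg fun x => sq_nonneg _
    have h3 : 0 ≤ ∫ x, (f x)^2 := integral_nonneg fun x => sq_nonneg _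
    positivity
  have hSq : ∀ n, ∫ x, (SS L f p n x)^2 ≤ ∫ x, (f x)^2 := by
    intro n
    cases n with
    | zero =>
      simp only [SS]
      simpa using (integral_nonneg fun x => sq_nonneg (f x) : 0 ≤ ∫ x, (f x)^2)
    | succ n => exact SS_energy D n
  have hI : ∀ n, ∫ x, Fp f p (SS L f p n) x ≤ J := by
    intro n
    obtain ⟨hc, ⟨B, hB⟩, _⟩ := SS_basic D n
    have hi := D.psi hc.measurable hB
    have hs2 := SS_sq_integrable D n
    unfold Fp
    rw [integral_add D.fi hi, hJ]
    have h6 : ∫ x, p x * SS L f p n x ≤ ∫ x, ((1/2) * (p x)^2 + (1/2) * (SS L f p n x)^2) := by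
      refine integral_mono hi ((hp2.const_mul _).add (hs2.const_mul _)) fun x => ?_
      simp only
      nlinarith [sq_nonneg (p x - SS L f p n x)]
    rw [integral_add (hp2.const_mul _) (hs2.const_mul _), integral_const_mul,
      integral_const_mul] at h6
    linarith [hSq n]
  set τ : ℝ := 1 / (2 * (P + 1)) with hτ
  have hτ0 : 0 < τ := by positivity
  set Q := (4 * Real.pi * τ) ^ (-(d : ℝ) / 2) with hQ
  have hQ0 : 0 ≤ Q := by positivity
  refine ⟨2 * (τ * Bf + Q * J), fun n => ?_⟩
  set M := 2 * (τ * Bf + Q * J) with hM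
  have hM0 : 0 ≤ M := by positivity
  induction n with
  | zero => intro x; simpa [SS] using hM0
  | succ n ih =>
    intro x
    rw [abs_of_nonneg (SS_nonneg D _ x)]
    obtain ⟨hc, _, _⟩ := SS_basic D n
    have h := RR_tau D.hL (Fp_GF D hc.measurable ih)
      (fun y => add_nonneg (D.f0 y) (mul_nonneg (D.p0 y) (SS_nonneg D n y))) hτ0 x
    have h1 : Q * ∫ y, Fp f p (SS L f p n) y ≤ Q * J := by gcongr; exact hI n
    have h2 : τ * (P * M) ≤ M / 2 := by
      rw [hτ, div_mul_eq_mul_div, one_mul, div_le_iff₀ (by positivity)]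
      nlinarith
    have h3 : SS L f p (n+1) x = RR L (Fp f p (SS L f p n)) x := rfl
    rw [h3]
    refine h.trans ?_
    rw [mul_add]
    linarith

theorem core_exists (D : Dat L f p Bf P α Af Ap) {x0 : Eu d} (hx0 : f x0 ≠ 0) :
    ∃ u : Eu d → ℝ, ContDiff ℝ 2 u ∧ (∀ x, 0 < u x) ∧
      ∀ x, laplacian u x = L * u x - (f x + p x * u x) := by
  obtain ⟨M, hM⟩ := SS_bdd D
  have hM0 : 0 ≤ M := (abs_nonneg _).trans (hM 0 0)
  have hmono : ∀ x, Monotone fun n => SS L f p n x := fun x =>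
    monotone_nat_of_le_succ fun n => SS_mono D n x
  let u : Eu d → ℝ := fun x => ⨆ n, SS L f p n x
  have hlim : ∀ x, Tendsto (fun n => SS L f p n x) atTop (nhds (u x)) := fun x =>
    tendsto_atTop_ciSup (hmono x) ⟨M, by
      rintro _ ⟨n, rfl⟩
      exact (le_abs_self _).trans (hM n x)⟩
  have hum : Measurable u := measurable_of_tendsto_metrizable
    (fun n => (SS_basic D n).1.measurable) (tendsto_pi_nhds.2 hlim)
  have huM : ∀ x, |u x| ≤ M := fun x =>
    le_of_tendsto (hlim x).abs (Eventually.of_forall fun n => hM n x)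
  have hu0 : ∀ x, 0 ≤ u x := fun x => ge_of_tendsto' (hlim x) fun n => SS_nonneg D n x
  have hfix : u = RR L (Fp f p u) := by
    funext x
    have h1 := RR_tendsto (F := fun n => Fp f p (SS L f p n)) (F' := Fp f p u)
      (G := fun x => f x + p x * M) D.hL (fun n => Fp_GF D (SS_basic D n).1.measurable (hM n))
      (D.fi.add (D.pi.mul_const M)) (fun n x => ?_) (fun x => ?_) x
    · have h2 := (hlim x).comp (tendsto_add_atTop_nat 1)
      exact tendsto_nhds_unique h2 h1
    · refine (abs_add_le _ _).trans ?_
      rw [abs_of_nonneg (D.f0 x), abs_mul, abs_of_nonneg (D.p0 x)]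
      exact add_le_add le_rfl (mul_le_mul_of_nonneg_left (hM n x) (D.p0 x))
    · exact ((hlim x).const_mul (p x)).const_add (f x)
  have hG := Fp_GF D hum huM
  have hcont : Continuous u := by rw [hfix]; exact RR_continuous D.hL hG
  have hlip : ∀ x y, |u y - u x| ≤ (CK d * (Bf + P * M) * Real.Gamma (1/2)) * ‖y - x‖ := by
    intro x y
    have := RR_lip D.hL hG x y
    rwa [← hfix] at this
  have hΛ : 0 ≤ CK d * (Bf + P * M) * Real.Gamma (1/2) := by
    have := CK_pos d
    have := hG.B_nonneg
    have := Real.Gamma_pos_of_pos one_half_pos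
    positivity
  obtain ⟨s1, s2⟩ := step D hcont huM hΛ hlip
  rw [← hfix] at s1 s2
  refine ⟨u, s1, fun x => ?_, s2⟩
  have hGf : GF f Bf := ⟨D.fc.measurable, D.fi, fun x => by
    rw [abs_of_nonneg (D.f0 x)]; exact D.fB x⟩
  have h1 := RR_pos D.hL hGf D.fc D.f0 hx0 x
  have h2 := RR_mono D.hL hGf hG (fun x => by
    have := mul_nonneg (D.p0 x) (hu0 x)
    unfold Fp; linarith) x
  rw [← hfix] at h2
  linarith

theorem log_riccati {u : Eu d → ℝ} (hu : ContDiff ℝ 2 u) (hpos : ∀ x, 0 < u x) :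
    ContDiff ℝ 2 (fun x => -Real.log (u x)) ∧
    ∀ x, -laplacian (fun x => -Real.log (u x)) x + gsq (fun x => -Real.log (u x)) x
      = laplacian u x / u x := by
  refine ⟨(hu.log fun x => (hpos x).ne').neg, fun x => ?_⟩
  have hd : ∀ x, HasFDerivAt u (fderiv ℝ u x) x := fun x =>
    (hu.differentiable (by norm_num) x).hasFDerivAt
  have h1 : ∀ x, HasFDerivAt (fun x => -Real.log (u x)) (-((u x)⁻¹ • fderiv ℝ u x)) x := fun x =>
    ((hd x).log (hpos x).ne').neg
  have e1 : fderiv ℝ (fun x => -Real.log (u x)) = fun x => -((u x)⁻¹ • fderiv ℝ u x) :=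
    funext fun x => (h1 x).fderiv
  have hd2 : HasFDerivAt (fderiv ℝ u) (fderiv ℝ (fderiv ℝ u) x) x :=
    ((hu.fderiv_right (m := 1) (by norm_num)).differentiable (by norm_num) x).hasFDerivAt
  have hinv : HasFDerivAt (fun x => (u x)⁻¹) (-((u x)^2)⁻¹ • fderiv ℝ u x) x := 
    (hasDerivAt_inv (hpos x).ne').comp_hasFDerivAt x (hd x)
  have h2 := (hinv.smul hd2).neg
  have e2 : fderiv ℝ (fun x => -((u x)⁻¹ • fderiv ℝ u x)) x = _ := h2.fderiv
  unfold laplacian gsq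
  rw [e1, e2, ← Finset.sum_neg_distrib, ← Finset.sum_add_distrib, Finset.sum_div]
  refine Finset.sum_congr rfl fun i _ => ?_
  have := (hpos x).ne'
  simp
  field_simp
  ring

end limit


section geom
variable {d : ℕ}

theorem bump_lip {c : Eu d} (θ : ContDiffBump c) : ∃ Λ : ℝ, 0 ≤ Λ ∧
    ∀ x y, |θ y - θ x| ≤ Λ * ‖y - x‖ := by
  obtain ⟨Λ, hΛ⟩ := ContDiff.lipschitzWith_of_hasCompactSupport (𝕂 := ℝ) (n := 1)
    θ.hasCompactSupport θ.contDiff one_ne_zero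
  refine ⟨Λ, Λ.2, fun x y => ?_⟩
  simpa [dist_eq_norm] using hΛ.dist_le_mul y x

theorem solve {r : ℝ} (hr : 0 < r) (hd : 0 < d) : ∃ C0 : ℝ, ∀ V : Eu d → ℝ, Continuous V →
    (∀ K : Set (Eu d), IsCompact K →
      ∃ C > (0:ℝ), ∃ α ∈ Set.Ioc (0:ℝ) 1, ∀ x ∈ K, ∀ x' ∈ K,
        |V x - V x'| ≤ C * ‖x - x'‖ ^ α) →
    ∀ (a : ℝ) (y : Eu d),
    (∀ z : Eu d, ‖z - y‖ < 3 * r → ∀ u : Eu d → ℝ, ContDiff ℝ (⊤ : ℕ∞) u → HasCompactSupport u →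
      tsupport u ⊆ ball z r → (a + C0) * ∫ x, (u x)^2 ≤ ∫ x, (gsq u x + V x * (u x)^2)) →
    ∃ v : Eu d → ℝ, ContDiff ℝ 2 v ∧ ∀ x ∈ ball y r, -laplacian v x + gsq v x + a = V x := by
  obtain ⟨C, hC⟩ := ims (d := d) hr
  refine ⟨C + 1, fun V Vc hV a y hyp => ?_⟩
  have hK : IsCompact (closedBall y (4*r)) := isCompact_closedBall _ _
  obtain ⟨Cv, hCv, α, ⟨a0, a1⟩, hH⟩ := hV _ hK
  obtain ⟨W, hW⟩ := hK.exists_bound_of_continuousOn (f := fun x => V x - a) (by fun_prop)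
  obtain ⟨L, hL1, hLC, hLW⟩ : ∃ L : ℝ, 1 ≤ L ∧ C + 1 ≤ L ∧ W ≤ L :=
    ⟨max 1 (max (C+1) W), by simp, by simp, by simp⟩
  have hVa : ∀ x ∈ closedBall y (4*r), |V x - a| ≤ L := fun x hx => (hW x hx).trans hLW
  let θ : ContDiffBump y := ⟨r, 2*r, hr, by linarith⟩
  have hθ0 : ∀ x, 2 * r ≤ dist x y → θ x = 0 := fun x hx => θ.zero_of_le_dist hx
  have hθK : ∀ x, x ∉ closedBall y (4*r) → θ x = 0 := fun x hx => by
    refine hθ0 x ?_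
    rw [mem_closedBall, not_le] at hx
    linarith
  have hθ1 : ∀ x ∈ ball y r, θ x = 1 := fun x hx =>
    θ.one_of_mem_closedBall (ball_subset_closedBall hx)
  have hθn : ∀ x, 0 ≤ θ x := fun x => θ.nonneg
  have hθl : ∀ x, θ x ≤ 1 := fun x => θ.le_one
  let g : Eu d → ℝ := fun x => L - (V x - a)
  have gc : Continuous g := by fun_prop
  have g0 : ∀ x ∈ closedBall y (4*r), 0 ≤ g x := fun x hx => by
    have := (abs_le.1 (hVa x hx)).2
    simp only [g]; linarith
  have g2 : ∀ x ∈ closedBall y (4*r), g x ≤ 2 * L := fun x hx => by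
    have := (abs_le.1 (hVa x hx)).1
    simp only [g]; linarith
  let p : Eu d → ℝ := fun x => θ x * g x
  have pc : Continuous p := θ.continuous.mul gc
  have ps : HasCompactSupport p := θ.hasCompactSupport.mul_right
  have p0 : ∀ x, 0 ≤ p x := fun x => by
    by_cases hx : x ∈ closedBall y (4*r)
    · exact mul_nonneg (hθn x) (g0 x hx)
    · simp [p, hθK x hx]
  have pP : ∀ x, p x ≤ 2 * L := fun x => by
    by_cases hx : x ∈ closedBall y (4*r)
    · have := g0 x hx
      have := g2 x hx
      have := hθl x
      have := hθn x
      simp only [p]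
      nlinarith
    · simp only [p, hθK x hx, zero_mul]; linarith
  obtain ⟨Λ, hΛ, hlip⟩ := bump_lip θ
  have hθH := lip_holder hΛ (fun x => by rw [abs_of_nonneg (hθn x)]; exact hθl x) a0 a1 hlip
  have pH1 : ∀ x z, z ∈ closedBall y (4*r) →
      |p z - p x| ≤ ((Λ + 2 * 1) * (2 * L) + Cv) * ‖z - x‖ ^ α := by
    intro x z hz
    have e : p z - p x = (θ z - θ x) * g z + θ x * (g z - g x) := by simp only [p]; ring
    have hN : 0 ≤ ‖z - x‖ ^ α := by positivity
    have h1 : |(θ z - θ x) * g z| ≤ ((Λ + 2 * 1) * ‖z - x‖ ^ α) * (2 * L) := by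
      rw [abs_mul, abs_of_nonneg (g0 z hz)]
      exact mul_le_mul (hθH x z) (g2 z hz) (g0 z hz) (by positivity)
    have h2 : |θ x * (g z - g x)| ≤ Cv * ‖z - x‖ ^ α := by
      by_cases hx : x ∈ closedBall y (4*r)
      · rw [abs_mul, abs_of_nonneg (hθn x)]
        have h3 : |g z - g x| ≤ Cv * ‖z - x‖ ^ α := by
          have : g z - g x = -(V z - V x) := by simp only [g]; ring
          rw [this, abs_neg]
          exact hH z hz x hx
        calc _ ≤ 1 * |g z - g x| := mul_le_mul_of_nonneg_right (hθl x) (abs_nonneg _)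
          _ ≤ _ := by rwa [one_mul]
      · rw [hθK x hx, zero_mul, abs_zero]; positivity
    rw [e]
    calc _ ≤ _ := abs_add_le _ _
      _ ≤ _ := add_le_add h1 h2
      _ = _ := by ring
  have pH : ∀ x z, |p z - p x| ≤ ((Λ + 2 * 1) * (2 * L) + Cv) * ‖z - x‖ ^ α := by
    intro x z
    by_cases hz : z ∈ closedBall y (4*r)
    · exact pH1 x z hz
    by_cases hx : x ∈ closedBall y (4*r)
    · rw [abs_sub_comm, norm_sub_rev]; exact pH1 z x hx
    · have e1 : p z = 0 := by simp [p, hθK z hz]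
      have e2 : p x = 0 := by simp [p, hθK x hx]
      rw [e1, e2, sub_zero, abs_zero]
      positivity
  have Uc : Continuous fun x => L - p x := by fun_prop
  have hloc : ∀ z : Eu d, ∀ u : Eu d → ℝ, ContDiff ℝ (⊤ : ℕ∞) u → HasCompactSupport u →
      tsupport u ⊆ ball z r →
      (C + 1) * ∫ x, (u x)^2 ≤ ∫ x, (gsq u x + (L - p x) * (u x)^2) := by
    intro z u hu huc hus
    have hu1 : ContDiff ℝ 1 u := hu.of_le (by exact_mod_cast le_top)
    have cu := hu.continuous
    have ig : Integrable (gsq u) :=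
      (continuous_gsq hu1).integrable_of_hasCompactSupport (gsq_compact huc)
    have iq : ∀ q : Eu d → ℝ, Continuous q → Integrable fun x => q x * (u x)^2 := by
      intro q hq
      refine Continuous.integrable_of_hasCompactSupport (by fun_prop) ?_
      refine huc.mono fun x hx hz => ?_
      simp [hz] at hx
    have i2 : Integrable fun x => (u x)^2 := by simpa using iq (fun _ => 1) continuous_const
    have hux : ∀ x, x ∉ ball z r → u x = 0 := fun x hx =>
      image_eq_zero_of_notMem_tsupport fun h => hx (hus h)
    by_cases hz : ‖z - y‖ < 3 * r
    · have h1 := hyp z hz u hu huc hus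
      have h2 : ∫ x, (gsq u x + V x * (u x)^2) - a * (u x)^2
          ≤ ∫ x, (gsq u x + (L - p x) * (u x)^2) := by
        refine integral_mono ((ig.add (iq V Vc)).sub (i2.const_mul a)) (ig.add (iq _ Uc)) fun x => ?_
        simp only
        by_cases hx : x ∈ ball z r
        · have hxK : x ∈ closedBall y (4*r) := by
            rw [mem_ball] at hx
            rw [← dist_eq_norm] at hz
            rw [mem_closedBall]
            linarith [dist_triangle x z y]
          have h3 : 0 ≤ (1 - θ x) * g x := mul_nonneg (by linarith [hθl x]) (g0 x hxK)
          have h4 : L - p x = (1 - θ x) * g x + (V x - a) := by simp only [p, g]; ring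
          rw [h4]
          nlinarith [mul_nonneg h3 (sq_nonneg (u x))]
        · rw [hux x hx]; simp
      have i6 : Integrable fun x => gsq u x + V x * (u x)^2 := ig.add (iq V Vc)
      rw [integral_sub i6 (i2.const_mul a), integral_const_mul] at h2
      linarith
    · have h2 : ∫ x, (C + 1) * (u x)^2 ≤ ∫ x, (gsq u x + (L - p x) * (u x)^2) := by
        refine integral_mono (i2.const_mul _) (ig.add (iq _ Uc)) fun x => ?_
        simp only
        have h0 := gsq_nonneg u x
        by_cases hx : x ∈ ball z r
        · have : θ x = 0 := by
            refine hθ0 x ?_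
            rw [mem_ball, dist_comm] at hx
            rw [← dist_eq_norm] at hz
            linarith [dist_triangle z x y]
          have hp : p x = 0 := by simp [p, this]
          rw [hp, sub_zero]
          have : (C+1) * (u x)^2 ≤ L * (u x)^2 := by gcongr
          linarith
        · rw [hux x hx]; simpa using h0
      rwa [integral_const_mul] at h2
  let i0 : Fin d := ⟨0, hd⟩
  let c : Eu d := y + (3 * r) • ee i0
  have hcy : dist y c = 3 * r := by
    simp [c, dist_eq_norm, norm_smul, abs_of_pos hr, ee]
  let F : ContDiffBump c := ⟨r/4, r/2, by linarith, by linarith⟩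
  obtain ⟨ΛF, hΛF, hlipF⟩ := bump_lip F
  have D : Dat L F p 1 (2*L) α (ΛF + 2 * 1) ((Λ + 2 * 1) * (2 * L) + Cv) := {
    hL := hL1
    fc := F.continuous
    pc := pc
    fs := F.hasCompactSupport
    ps := ps
    f0 := fun x => F.nonneg
    p0 := p0
    fB := fun x => F.le_one
    pP := pP
    a0 := a0
    a1 := a1
    Af0 := by positivity
    Ap0 := by positivity
    fH := lip_holder hΛF (fun x => by rw [abs_of_nonneg F.nonneg]; exact F.le_one) a0 a1 hlipF
    pH := pH
    form := fun φ h1 h2 => by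
      have := form_C1 Uc (hC _ Uc _ hloc) h1 h2
      simpa using this }
  have hFc : F c ≠ 0 := by
    rw [F.one_of_mem_closedBall (mem_closedBall_self (by linarith [F.rIn_pos]))]
    exact one_ne_zero
  obtain ⟨u, hu2, hupos, hlap⟩ := core_exists D hFc
  obtain ⟨v2, hv⟩ := log_riccati hu2 hupos
  refine ⟨_, v2, fun x hx => ?_⟩
  have hFx : F x = 0 := by
    refine F.zero_of_le_dist ?_
    rw [mem_ball, dist_comm] at hx
    show r/2 ≤ dist x c
    linarith [dist_triangle y x c]
  rw [hv x, hlap x, hFx]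
  have hne := (hupos x).ne'
  have : p x = L - (V x - a) := by simp [p, g, hθ1 x hx]
  rw [this]
  field_simp
  ring

theorem solve_ball {V : Eu d → ℝ} {y : Eu d} {r : ℝ} {A : ℝ} {u : Eu d → ℝ}
    (hus : tsupport u ⊆ ball y r) :
    (∫ x in ball y r, (u x)^2 = ∫ x, (u x)^2) ∧
    (∫ x in ball y r, (‖gradient u x‖ ^ 2 + V x * (u x) ^ 2) = ∫ x, (gsq u x + V x * (u x)^2)) := by
  have hux : ∀ x, x ∉ ball y r → u x = 0 := fun x hx =>
      image_eq_zero_of_notMem_tsupport fun h => hx (hus h)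
  simp only [gradient_sq]
  refine ⟨setIntegral_eq_integral_of_forall_compl_eq_zero fun x hx => ?_,
    setIntegral_eq_integral_of_forall_compl_eq_zero fun x hx => ?_⟩
  · simp [hux x hx]
  · rw [hux x hx, gsq_eq_zero fun h => hx (hus h)]; simp

end geom

theorem statement2 (d : ℕ) (hd : 3 ≤ d) (V : EuclideanSpace ℝ (Fin d) → ℝ)
    (hV : ∀ K : Set (EuclideanSpace ℝ (Fin d)), IsCompact K →
      ∃ C > (0:ℝ), ∃ α ∈ Set.Ioc (0:ℝ) 1, ∀ x ∈ K, ∀ x' ∈ K,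
        |V x - V x'| ≤ C * ‖x - x'‖ ^ α)
    (r : ℝ) (hr : 0 < r) :
    (∀ A : ℝ, ∃ R₁ : ℝ, ∀ y : EuclideanSpace ℝ (Fin d), R₁ ≤ ‖y‖ →
      ∀ u : EuclideanSpace ℝ (Fin d) → ℝ, ContDiff ℝ (⊤ : ℕ∞) u → HasCompactSupport u →
        tsupport u ⊆ ball y r → u ≠ 0 →
        A * ∫ x in ball y r, (u x) ^ 2 ≤
          ∫ x in ball y r, (‖gradient u x‖ ^ 2 + V x * (u x) ^ 2)) ↔
    (∃ R > (0:ℝ), ∃ lam : EuclideanSpace ℝ (Fin d) → ℝ,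
      (∀ M : ℝ, ∃ R₁ : ℝ, ∀ y : EuclideanSpace ℝ (Fin d), R₁ ≤ ‖y‖ → M ≤ lam y) ∧
      ∀ y : EuclideanSpace ℝ (Fin d), R ≤ ‖y‖ →
        ∃ v : EuclideanSpace ℝ (Fin d) → ℝ,
          ContinuousOn v (closure (ball y r)) ∧ ContDiffOn ℝ 2 v (ball y r) ∧
          ∀ x ∈ ball y r, -laplacian v x + ‖gradient v x‖ ^ 2 + lam y = V x) := by
  have Vc : Continuous V := by
    rw [continuous_iff_continuousAt]
    intro x
    obtain ⟨C, hC, α, ⟨a0, a1⟩, hH⟩ := hV (closedBall x 1) (isCompact_closedBall _ _)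
    rw [ContinuousAt, tendsto_iff_dist_tendsto_zero]
    have h1 : Tendsto (fun z => C * ‖z - x‖ ^ α) (nhds x) (nhds 0) := by
      have : Continuous fun z : EuclideanSpace ℝ (Fin d) => C * ‖z - x‖ ^ α :=
        continuous_const.mul ((continuous_id.sub continuous_const).norm.rpow_const
          fun _ => Or.inr a0.le)
      simpa [Real.zero_rpow a0.ne'] using this.tendsto x
    refine squeeze_zero' (Eventually.of_forall fun _ => dist_nonneg) ?_ h1
    filter_upwards [closedBall_mem_nhds x one_pos] with z hz
    exact hH z hz x (mem_closedBall_self zero_le_one)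
  constructor
  · intro h
    obtain ⟨C0, hC0⟩ := solve (d := d) hr (by omega)
    have hS : ∀ a : ℝ, ∃ Ra : ℝ, ∀ y : EuclideanSpace ℝ (Fin d), Ra ≤ ‖y‖ →
        ∃ v : EuclideanSpace ℝ (Fin d) → ℝ, ContDiff ℝ 2 v ∧
          ∀ x ∈ ball y r, -laplacian v x + gsq v x + a = V x := by
      intro a
      obtain ⟨R₁, hR₁⟩ := h (a + C0)
      refine ⟨R₁ + 3 * r, fun y hy => hC0 V Vc hV a y fun z hz u hu huc hus => ?_⟩
      by_cases hu0 : u = 0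
      · subst hu0
        have : ∀ x, gsq (0 : Eu d → ℝ) x = 0 := fun x => gsq_eq_zero (by simp [tsupport])
        simp [this]
      have hz' : R₁ ≤ ‖z‖ := by
        have := norm_sub_norm_le y z
        rw [norm_sub_rev] at this
        linarith
      have h1 := hR₁ z hz' u hu huc hus hu0
      obtain ⟨e1, e2⟩ := solve_ball (V := V) (A := 0) hus
      rwa [e1, e2] at h1
    classical
    let S : EuclideanSpace ℝ (Fin d) → ℕ → Prop := fun y n =>
      ∃ v : EuclideanSpace ℝ (Fin d) → ℝ, ContDiff ℝ 2 v ∧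
          ∀ x ∈ ball y r, -laplacian v x + gsq v x + (n:ℝ) = V x
    obtain ⟨R0, hR0⟩ := hS 0
    refine ⟨max R0 1, by positivity, fun y => (Nat.findGreatest (S y) ⌊‖y‖⌋₊ : ℕ), fun M => ?_,
      fun y hy => ?_⟩
    · obtain ⟨n, hn⟩ := exists_nat_ge M
      obtain ⟨Rn, hRn⟩ := hS n
      refine ⟨max Rn n, fun y hy => hn.trans ?_⟩
      have h1 : n ≤ Nat.findGreatest (S y) ⌊‖y‖⌋₊ :=
        Nat.le_findGreatest (Nat.le_floor ((le_max_right _ _).trans hy))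
          (hRn y ((le_max_left _ _).trans hy))
      simp only
      exact_mod_cast h1
    · have h0 : S y 0 := by
        simpa [S] using hR0 y ((le_max_left _ _).trans hy)
      obtain ⟨v, hv, hv2⟩ := Nat.findGreatest_spec (Nat.zero_le ⌊‖y‖⌋₊) h0
      refine ⟨v, hv.continuous.continuousOn, hv.contDiffOn, fun x hx => ?_⟩
      rw [gradient_sq]
      exact hv2 x hx
  · rintro ⟨R, hR, lam, hlam, hsol⟩ A
    obtain ⟨R₁, hR₁⟩ := hlam A
    refine ⟨max R R₁, fun y hy u hu huc hus hu0 => ?_⟩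
    obtain ⟨v, -, hv, heq⟩ := hsol y ((le_max_left _ _).trans hy)
    have hl := hR₁ y ((le_max_right _ _).trans hy)
    obtain ⟨e1, e2⟩ := solve_ball (V := V) (A := 0) hus
    rw [e1, e2]
    have h1 := easy_ball Vc hv (l := lam y) (fun x hx => by
      rw [← gradient_sq]; exact heq x hx) hu huc hus
    refine le_trans ?_ h1
    have : 0 ≤ ∫ x, (u x)^2 := integral_nonneg fun x => sq_nonneg _
    gcongr
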